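/- arXiv:math/0504203 — 6 statements merged into one kernel-verified Lean document; each statement's English description precedes it below -/
import Mathlib

section
/- Let Ω ⊆ ℝ² be open and connected and let f : Ω × ℝ → ℝ be real-analytic, viewed as the right-hand side of the second-order ODE y'' = f(x, y, y') with coordinates (x, y, p) (p standing for y'). Then the following are equivalent: (a) for every point (x₀, y₀) ∈ Ω there exist an open connected neighborhood Ω' ⊆ Ω of (x₀, y₀) and a real-analytic function η : Ω' → ℝ with ∂η/∂y ≠ 0 everywhere on Ω' such that η_{xx}(x,y) + 2p·η_{xy}(x,y) + p²·η_{yy}(x,y) + η_y(x,y)·f(x,y,p) = 0 for all (x,y) ∈ Ω' and all p ∈ ℝ; (b) f satisfies on Ω × ℝ the two identities f_{ppp} = 0 and f_{xp} = −f_{pp}·f + 2·f_y + (1/2)·f_p² − p·f_{yp}. -/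
/-- Partial derivative in the first variable `x` of a function of `(x, y, p)`. -/
noncomputable def pdx (g : ℝ → ℝ → ℝ → ℝ) : ℝ → ℝ → ℝ → ℝ :=
  fun x y p => deriv (fun t => g t y p) x

/-- Partial derivative in the second variable `y` of a function of `(x, y, p)`. -/
noncomputable def pdy (g : ℝ → ℝ → ℝ → ℝ) : ℝ → ℝ → ℝ → ℝ :=
  fun x y p => deriv (fun t => g x t p) y

/-- Partial derivative in the third variable `p` of a function of `(x, y, p)`. -/
noncomputable def pdp (g : ℝ → ℝ → ℝ → ℝ) : ℝ → ℝ → ℝ → ℝ :=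
  fun x y p => deriv (fun t => g x y t) p

/-- Partial derivative in `x` of a function of `(x, y)`. -/
noncomputable def edx (g : ℝ → ℝ → ℝ) : ℝ → ℝ → ℝ :=
  fun x y => deriv (fun t => g t y) x

/-- Partial derivative in `y` of a function of `(x, y)`. -/
noncomputable def edy (g : ℝ → ℝ → ℝ) : ℝ → ℝ → ℝ :=
  fun x y => deriv (fun t => g x t) y

open Filter Topology

section Primitive

variable {E F : Type*} [NormedAddCommGroup E] [NormedSpace ℝ E]
  [NormedAddCommGroup F] [NormedSpace ℝ F]

theorem AnalyticAt.clm_apply_real {G : Type*} [NormedAddCommGroup G] [NormedSpace ℝ G]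
    {l : E → G →L[ℝ] F} {v : E → G} {P : E} (hl : AnalyticAt ℝ l P) (hv : AnalyticAt ℝ v P) :
    AnalyticAt ℝ (fun w => l w (v w)) P :=
  AnalyticAt.comp₂ (h := fun z : (G →L[ℝ] F) × G => z.1 z.2)
    ((ContinuousLinearMap.id ℝ (G →L[ℝ] F)).analyticAt_bilinear _) hl hv

variable [CompleteSpace F]

theorem HasFPowerSeriesOnBall.integral_segment {ω : E → F} {p : FormalMultilinearSeries ℝ E F}
    {P : E} {r : ENNReal} (h : HasFPowerSeriesOnBall ω p P r) :
    HasFPowerSeriesOnBall (fun w => ∫ t in (0 : ℝ)..1, ω (P + t • (w - P)))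
      (fun n => ((n : ℝ) + 1)⁻¹ • p n) P r where
  r_le := by
    refine h.r_le.trans (FormalMultilinearSeries.radius_le_of_le fun n => ?_)
    rw [norm_smul]
    refine mul_le_of_le_one_left (norm_nonneg _) ?_
    rw [Real.norm_of_nonneg (by positivity)]
    exact inv_le_one_of_one_le₀ (by linarith [n.cast_nonneg (α := ℝ)])
  r_pos := h.r_pos
  hasSum := by
    intro y hy
    have hyr : (‖y‖₊ : ENNReal) < p.radius := by
      refine lt_of_lt_of_le ?_ h.r_le
      simpa [enorm] using hy
    have hsum : Summable fun n => ‖p n‖ * ‖y‖ ^ n := by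
      simpa only [coe_nnnorm] using p.summable_norm_mul_pow hyr
    have key : HasSum (fun n => ∫ t in (0 : ℝ)..1, t ^ n • p n (fun _ => y))
        (∫ t in (0 : ℝ)..1, ω (P + t • (P + y - P))) := by
      refine intervalIntegral.hasSum_integral_of_dominated_convergence
        (fun n _ => ‖p n‖ * ‖y‖ ^ n) (fun n => ?_) (fun n => ?_) ?_ ?_ ?_
      · exact (by fun_prop : Continuous fun t : ℝ => t ^ n • p n (fun _ => y)).aestronglyMeasurable
      · refine .of_forall fun t ht => ?_
        rw [Set.uIoc_of_le zero_le_one] at ht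
        rw [norm_smul, norm_pow, Real.norm_of_nonneg ht.1.le]
        refine (mul_le_of_le_one_left (norm_nonneg _) (pow_le_one₀ ht.1.le ht.2)).trans ?_
        simpa using (p n).le_opNorm (fun _ => y)
      · exact .of_forall fun t _ => hsum
      · exact intervalIntegrable_const
      · refine .of_forall fun t ht => ?_
        rw [Set.uIoc_of_le zero_le_one] at ht
        have hty : t • y ∈ Metric.eball (0 : E) r := by
          rw [Metric.mem_eball, edist_zero_right] at hy ⊢
          refine lt_of_le_of_lt ?_ hy
          rw [enorm_smul]
          refine mul_le_of_le_one_left zero_le ?_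
          rw [Real.enorm_of_nonneg ht.1.le]
          exact ENNReal.ofReal_le_one.2 ht.2
        have := h.hasSum hty
        simpa [(p _).map_smul_univ (fun _ => t) (fun _ => y)] using this
    convert key using 2 with n
    rw [intervalIntegral.integral_smul_const, integral_pow]
    simp

theorem AnalyticAt.of_hasFDerivAt {G : E → F} {ω : E → E →L[ℝ] F} {P : E}
    (hω : AnalyticAt ℝ ω P) (hG : ∀ᶠ w in 𝓝 P, HasFDerivAt G (ω w) w) : AnalyticAt ℝ G P := by
  obtain ⟨p, r, hp⟩ := id hω
  have hR : AnalyticAt ℝ (fun w => ∫ t in (0 : ℝ)..1, ω (P + t • (w - P))) P :=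
    hp.integral_segment.analyticAt
  have hA : AnalyticAt ℝ
      (fun w => G P + (∫ t in (0 : ℝ)..1, ω (P + t • (w - P))) (w - P)) P :=
    analyticAt_const.add (hR.clm_apply_real (analyticAt_id.sub analyticAt_const))
  refine hA.congr ?_
  obtain ⟨ε, hε, hball⟩ := Metric.eventually_nhds_iff_ball.1 (hG.and hω.eventually_continuousAt)
  filter_upwards [Metric.ball_mem_nhds P hε] with w hw
  have hmem : ∀ t ∈ Set.uIcc (0 : ℝ) 1, P + t • (w - P) ∈ Metric.ball P ε := by
    intro t ht
    rw [Set.uIcc_of_le zero_le_one] at ht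
    exact (convex_ball P ε).add_smul_sub_mem (Metric.mem_ball_self hε) hw ht
  have hcω : ContinuousOn (fun t : ℝ => ω (P + t • (w - P))) (Set.uIcc 0 1) := fun t ht =>
    ((hball _ (hmem t ht)).2.comp (f := fun t : ℝ => P + t • (w - P))
      (by fun_prop)).continuousWithinAt
  have hderiv : ∀ t ∈ Set.uIcc (0 : ℝ) 1,
      HasDerivAt (fun t : ℝ => G (P + t • (w - P))) (ω (P + t • (w - P)) (w - P)) t := by
    intro t ht
    have h1 : HasDerivAt (fun t : ℝ => P + t • (w - P)) (w - P) t := by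
      simpa using ((hasDerivAt_id t).smul_const (w - P)).const_add P
    exact (hball _ (hmem t ht)).1.comp_hasDerivAt t h1
  have hint := intervalIntegral.integral_eq_sub_of_hasDerivAt hderiv
    (hcω.clm_apply continuousOn_const).intervalIntegrable
  rw [ContinuousLinearMap.intervalIntegral_apply hcω.intervalIntegrable, hint]
  simp

end Primitive

section Partial

variable {g h : ℝ → ℝ → ℝ} {P : ℝ × ℝ}

theorem hasDerivAt_edx (hg : AnalyticAt ℝ (fun w : ℝ × ℝ => g w.1 w.2) P) :
    HasDerivAt (fun t => g t P.2) (edx g P.1 P.2) P.1 := by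
  have := hg.differentiableAt
  have h2 : DifferentiableAt ℝ (fun t => g t P.2) P.1 :=
    DifferentiableAt.comp (g := fun w : ℝ × ℝ => g w.1 w.2) (f := fun t => (t, P.2)) P.1
      this (by fun_prop)
  exact h2.hasDerivAt

theorem hasDerivAt_edy (hg : AnalyticAt ℝ (fun w : ℝ × ℝ => g w.1 w.2) P) :
    HasDerivAt (fun t => g P.1 t) (edy g P.1 P.2) P.2 := by
  have := hg.differentiableAt
  have h2 : DifferentiableAt ℝ (fun t => g P.1 t) P.2 :=
    DifferentiableAt.comp (g := fun w : ℝ × ℝ => g w.1 w.2) (f := fun t => (P.1, t)) P.2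
      this (by fun_prop)
  exact h2.hasDerivAt

theorem edx_eq_of_hasFDerivAt {g' : ℝ × ℝ →L[ℝ] ℝ}
    (hg : HasFDerivAt (fun w : ℝ × ℝ => g w.1 w.2) g' P) : edx g P.1 P.2 = g' (1, 0) := by
  have h1 : HasDerivAt (fun t : ℝ => (t, P.2)) ((1 : ℝ), (0 : ℝ)) P.1 :=
    (hasDerivAt_id _).prodMk (hasDerivAt_const _ _)
  exact (HasFDerivAt.comp_hasDerivAt (f := fun t : ℝ => (t, P.2)) P.1 hg h1).deriv

theorem edy_eq_of_hasFDerivAt {g' : ℝ × ℝ →L[ℝ] ℝ}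
    (hg : HasFDerivAt (fun w : ℝ × ℝ => g w.1 w.2) g' P) : edy g P.1 P.2 = g' (0, 1) := by
  have h1 : HasDerivAt (fun t : ℝ => (P.1, t)) ((0 : ℝ), (1 : ℝ)) P.2 :=
    (hasDerivAt_const _ _).prodMk (hasDerivAt_id _)
  exact (HasFDerivAt.comp_hasDerivAt (f := fun t : ℝ => (P.1, t)) P.2 hg h1).deriv

theorem eventually_edx_eq_fderiv (hg : AnalyticAt ℝ (fun w : ℝ × ℝ => g w.1 w.2) P) :
    (fun w : ℝ × ℝ => edx g w.1 w.2) =ᶠ[𝓝 P]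
      fun w => fderiv ℝ (fun w : ℝ × ℝ => g w.1 w.2) w (1, 0) :=
  hg.eventually_analyticAt.mono fun _ hw => edx_eq_of_hasFDerivAt hw.differentiableAt.hasFDerivAt

theorem eventually_edy_eq_fderiv (hg : AnalyticAt ℝ (fun w : ℝ × ℝ => g w.1 w.2) P) :
    (fun w : ℝ × ℝ => edy g w.1 w.2) =ᶠ[𝓝 P]
      fun w => fderiv ℝ (fun w : ℝ × ℝ => g w.1 w.2) w (0, 1) :=
  hg.eventually_analyticAt.mono fun _ hw => edy_eq_of_hasFDerivAt hw.differentiableAt.hasFDerivAt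

theorem AnalyticAt.edx (hg : AnalyticAt ℝ (fun w : ℝ × ℝ => g w.1 w.2) P) :
    AnalyticAt ℝ (fun w : ℝ × ℝ => edx g w.1 w.2) P :=
  (hg.fderiv.clm_apply_real analyticAt_const).congr (eventually_edx_eq_fderiv hg).symm

theorem AnalyticAt.edy (hg : AnalyticAt ℝ (fun w : ℝ × ℝ => g w.1 w.2) P) :
    AnalyticAt ℝ (fun w : ℝ × ℝ => edy g w.1 w.2) P :=
  (hg.fderiv.clm_apply_real analyticAt_const).congr (eventually_edy_eq_fderiv hg).symm

theorem edx_congr (hgh : ∀ᶠ w : ℝ × ℝ in 𝓝 P, g w.1 w.2 = h w.1 w.2) :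
    edx g P.1 P.2 = edx h P.1 P.2 := by
  have : Tendsto (fun t : ℝ => (t, P.2)) (𝓝 P.1) (𝓝 P) :=
    Continuous.tendsto (by fun_prop : Continuous fun t : ℝ => (t, P.2)) P.1
  exact EventuallyEq.deriv_eq (this.eventually hgh)

theorem edy_congr (hgh : ∀ᶠ w : ℝ × ℝ in 𝓝 P, g w.1 w.2 = h w.1 w.2) :
    edy g P.1 P.2 = edy h P.1 P.2 := by
  have : Tendsto (fun t : ℝ => (P.1, t)) (𝓝 P.2) (𝓝 P) :=
    Continuous.tendsto (by fun_prop : Continuous fun t : ℝ => (P.1, t)) P.2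
  exact EventuallyEq.deriv_eq (this.eventually hgh)

theorem edx_edy_comm (hg : AnalyticAt ℝ (fun w : ℝ × ℝ => g w.1 w.2) P) :
    edx (edy g) P.1 P.2 = edy (edx g) P.1 P.2 := by
  have hd := hg.fderiv.differentiableAt.hasFDerivAt
  have key : ∀ v : ℝ × ℝ, HasFDerivAt
      (fun w => fderiv ℝ (fun w : ℝ × ℝ => g w.1 w.2) w v)
      ((fderiv ℝ (fderiv ℝ (fun w : ℝ × ℝ => g w.1 w.2)) P).flip v) P := fun v => by
    simpa using hd.clm_apply (hasFDerivAt_const v P)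
  rw [edx_eq_of_hasFDerivAt (((key _).congr_of_eventuallyEq (eventually_edy_eq_fderiv hg))),
    edy_eq_of_hasFDerivAt (((key _).congr_of_eventuallyEq (eventually_edx_eq_fderiv hg)))]
  exact second_derivative_symmetric_of_eventually
    (hg.eventually_analyticAt.mono fun w hw => hw.differentiableAt.hasFDerivAt) hd _ _

/-- Analytic Poincaré lemma for `1`-forms `M dx + N dy` in the plane. -/
theorem exists_analyticAt_edx_eq_edy_eq {M N : ℝ → ℝ → ℝ}
    (hM : AnalyticAt ℝ (fun w : ℝ × ℝ => M w.1 w.2) P)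
    (hN : AnalyticAt ℝ (fun w : ℝ × ℝ => N w.1 w.2) P)
    (hMN : ∀ᶠ w : ℝ × ℝ in 𝓝 P, edy M w.1 w.2 = edx N w.1 w.2) :
    ∃ G : ℝ → ℝ → ℝ, AnalyticAt ℝ (fun w : ℝ × ℝ => G w.1 w.2) P ∧
      (∀ᶠ w : ℝ × ℝ in 𝓝 P, edx G w.1 w.2 = M w.1 w.2) ∧
      ∀ᶠ w : ℝ × ℝ in 𝓝 P, edy G w.1 w.2 = N w.1 w.2 := by
  let X := ContinuousLinearMap.fst ℝ ℝ ℝ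
  let Y := ContinuousLinearMap.snd ℝ ℝ ℝ
  let ω : ℝ × ℝ → ℝ × ℝ →L[ℝ] ℝ := fun w => M w.1 w.2 • X + N w.1 w.2 • Y
  have hω : AnalyticAt ℝ ω P := (hM.smul analyticAt_const).add (hN.smul analyticAt_const)
  obtain ⟨ε, hε, hball⟩ := Metric.eventually_nhds_iff_ball.1
    (hMN.and (hM.eventually_analyticAt.and hN.eventually_analyticAt))
  have hd : ∀ w ∈ Metric.ball P ε, HasFDerivAt ω
      ((fderiv ℝ (fun w : ℝ × ℝ => M w.1 w.2) w).smulRight X +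
        (fderiv ℝ (fun w : ℝ × ℝ => N w.1 w.2) w).smulRight Y) w := fun w hw =>
    ((hball w hw).2.1.differentiableAt.hasFDerivAt.smul_const X).add
      ((hball w hw).2.2.differentiableAt.hasFDerivAt.smul_const Y)
  obtain ⟨G, hG⟩ := (convex_ball P ε).exists_forall_hasFDerivAt_of_fderiv_symmetric
    (ω := ω) Metric.isOpen_ball (fun w hw => (hd w hw).differentiableAt.differentiableWithinAt) (by
      intro w hw x y
      obtain ⟨h1, h2, h3⟩ := hball w hw
      rw [edy_eq_of_hasFDerivAt h2.differentiableAt.hasFDerivAt,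
        edx_eq_of_hasFDerivAt h3.differentiableAt.hasFDerivAt] at h1
      have hlin : ∀ (l : ℝ × ℝ →L[ℝ] ℝ) (z : ℝ × ℝ), l z = z.1 * l (1, 0) + z.2 * l (0, 1) := by
        intro l z
        have : z = z.1 • ((1 : ℝ), (0 : ℝ)) + z.2 • ((0 : ℝ), (1 : ℝ)) := by ext <;> simp
        conv_lhs => rw [this, map_add, map_smul, map_smul]
        simp
      rw [(hd w hw).fderiv]
      simp only [X, Y, add_apply, ContinuousLinearMap.smulRight_apply,
        smul_apply, ContinuousLinearMap.coe_fst',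
        ContinuousLinearMap.coe_snd', smul_eq_mul]
      rw [hlin _ x, hlin _ y, hlin (fderiv ℝ (fun w : ℝ × ℝ => N w.1 w.2) w) x,
        hlin (fderiv ℝ (fun w : ℝ × ℝ => N w.1 w.2) w) y, h1]
      ring)
  have hGe : ∀ᶠ w in 𝓝 P, HasFDerivAt G (ω w) w :=
    eventually_of_mem (Metric.ball_mem_nhds P hε) hG
  refine ⟨fun x y => G (x, y), hω.of_hasFDerivAt hGe, ?_, ?_⟩
  · filter_upwards [hGe] with w hw
    rw [edx_eq_of_hasFDerivAt (g := fun x y => G (x, y)) hw]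
    simp [ω, X, Y]
  · filter_upwards [hGe] with w hw
    rw [edy_eq_of_hasFDerivAt (g := fun x y => G (x, y)) hw]
    simp [ω, X, Y]

end Partial

section Quadratic

theorem eq_quadratic_of_deriv_deriv_deriv_eq_zero {g : ℝ → ℝ} (hg : AnalyticOnNhd ℝ g Set.univ)
    (h : ∀ p, deriv (deriv (deriv g)) p = 0) (p : ℝ) :
    g p = g 0 + (g 1 - g (-1)) / 2 * p + ((g 1 + g (-1)) / 2 - g 0) * p ^ 2 := by
  have h0 : Differentiable ℝ g := fun p => (hg p trivial).differentiableAt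
  have h1 : Differentiable ℝ (deriv g) := fun p => (hg.deriv p trivial).differentiableAt
  have h2 : Differentiable ℝ (deriv (deriv g)) := fun p =>
    (hg.deriv.deriv p trivial).differentiableAt
  set c := deriv (deriv g) 0
  have e2 : ∀ p, deriv (deriv g) p = c := fun p => is_const_of_deriv_eq_zero h2 h p 0
  have e1 : ∀ p, deriv g p = deriv g 0 + c * p := by
    intro p
    have hd : ∀ q, HasDerivAt (fun q => deriv g q - c * q) 0 q := fun q =>
      ((h1 q).hasDerivAt.sub ((hasDerivAt_id q).const_mul c)).congr_deriv (by rw [e2]; ring)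
    have := is_const_of_deriv_eq_zero (fun q => (hd q).differentiableAt)
      (fun q => (hd q).deriv) p 0
    linear_combination this
  have e0 : ∀ p, g p = g 0 + deriv g 0 * p + c / 2 * p ^ 2 := by
    intro p
    have hd : ∀ q, HasDerivAt (fun q => g q - (deriv g 0 * q + c / 2 * q ^ 2)) 0 q := fun q =>
      ((h0 q).hasDerivAt.sub (((hasDerivAt_id q).const_mul (deriv g 0)).add
        (((hasDerivAt_id q).pow 2).const_mul (c / 2)))).congr_deriv (by
          rw [e1]
          simp
          ring)
    have := is_const_of_deriv_eq_zero (fun q => (hd q).differentiableAt)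
      (fun q => (hd q).deriv) p 0
    linear_combination this
  rw [e0 p, e0 1, e0 (-1)]
  ring

theorem deriv_quadratic (a b c p : ℝ) :
    deriv (fun t => a + b * t + c * t ^ 2) p = b + 2 * c * p := by
  have := (((hasDerivAt_id p).const_mul b).const_add a).add
    (((hasDerivAt_id p).pow 2).const_mul c)
  refine (this.congr_deriv ?_).deriv
  simp
  ring

variable {a b c : ℝ → ℝ → ℝ} {f : ℝ → ℝ → ℝ → ℝ} {P : ℝ × ℝ}

/-- For `f` quadratic in `p`, the linearizability conditions on `f` are equivalent to first-order
relations between its coefficients. -/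
theorem quadratic_conditions_iff
    (ha : AnalyticAt ℝ (fun w : ℝ × ℝ => a w.1 w.2) P)
    (hb : AnalyticAt ℝ (fun w : ℝ × ℝ => b w.1 w.2) P)
    (hc : AnalyticAt ℝ (fun w : ℝ × ℝ => c w.1 w.2) P)
    (hf : ∀ᶠ w : ℝ × ℝ in 𝓝 P, ∀ p,
      f w.1 w.2 p = a w.1 w.2 + b w.1 w.2 * p + c w.1 w.2 * p ^ 2) :
    (∀ p : ℝ,
      pdp (pdp (pdp f)) P.1 P.2 p = 0 ∧
      pdp (pdx f) P.1 P.2 p =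
        - pdp (pdp f) P.1 P.2 p * f P.1 P.2 p + 2 * pdy f P.1 P.2 p
          + (1 / 2) * (pdp f P.1 P.2 p) ^ 2 - p * pdp (pdy f) P.1 P.2 p) ↔
    2 * edx c P.1 P.2 = edy b P.1 P.2 ∧
      edx b P.1 P.2 = 2 * edy a P.1 P.2 - 2 * a P.1 P.2 * c P.1 P.2 + b P.1 P.2 ^ 2 / 2 := by
  have f0 : f P.1 P.2 = fun p => a P.1 P.2 + b P.1 P.2 * p + c P.1 P.2 * p ^ 2 :=
    funext hf.self_of_nhds
  have fp : pdp f P.1 P.2 = fun p => b P.1 P.2 + 2 * c P.1 P.2 * p := by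
    funext p
    simp only [pdp, f0]
    exact deriv_quadratic _ _ _ _
  have fpp : pdp (pdp f) P.1 P.2 = fun p => 2 * c P.1 P.2 := by
    funext p
    change deriv (pdp f P.1 P.2) p = _
    rw [fp]
    simp
  have fppp : pdp (pdp (pdp f)) P.1 P.2 = fun p => 0 := by
    funext p
    change deriv (pdp (pdp f) P.1 P.2) p = _
    rw [fpp]
    simp
  have fx : pdx f P.1 P.2 =
      fun p => edx a P.1 P.2 + edx b P.1 P.2 * p + edx c P.1 P.2 * p ^ 2 := by
    funext p
    have h1 := ((hasDerivAt_edx ha).add ((hasDerivAt_edx hb).mul_const p)).add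
      ((hasDerivAt_edx hc).mul_const (p ^ 2))
    rw [← HasDerivAt.deriv h1]
    exact edx_congr (g := fun x y => f x y p)
      (h := fun x y => a x y + b x y * p + c x y * p ^ 2) (hf.mono fun w hw => hw p)
  have fy : pdy f P.1 P.2 =
      fun p => edy a P.1 P.2 + edy b P.1 P.2 * p + edy c P.1 P.2 * p ^ 2 := by
    funext p
    have h1 := ((hasDerivAt_edy ha).add ((hasDerivAt_edy hb).mul_const p)).add
      ((hasDerivAt_edy hc).mul_const (p ^ 2))
    rw [← HasDerivAt.deriv h1]
    exact edy_congr (g := fun x y => f x y p)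
      (h := fun x y => a x y + b x y * p + c x y * p ^ 2) (hf.mono fun w hw => hw p)
  have fxp : ∀ p, pdp (pdx f) P.1 P.2 p = edx b P.1 P.2 + 2 * edx c P.1 P.2 * p := by
    intro p
    change deriv (pdx f P.1 P.2) p = _
    rw [fx]
    exact deriv_quadratic _ _ _ _
  have fyp : ∀ p, pdp (pdy f) P.1 P.2 p = edy b P.1 P.2 + 2 * edy c P.1 P.2 * p := by
    intro p
    change deriv (pdy f P.1 P.2) p = _
    rw [fy]
    exact deriv_quadratic _ _ _ _
  simp only [fppp, fxp, fpp, f0, fy, fp, fyp, true_and]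
  constructor
  · intro h
    constructor
    · linear_combination h 1 - h 0
    · linear_combination h 0
  · rintro ⟨h1, h2⟩ p
    linear_combination h2 + p * h1

end Quadratic

section Flat

variable {f : ℝ → ℝ → ℝ → ℝ} {P : ℝ × ℝ}

theorem conditions_of_flat {η : ℝ → ℝ → ℝ} (hη : AnalyticAt ℝ (fun w : ℝ × ℝ => η w.1 w.2) P)
    (h0 : edy η P.1 P.2 ≠ 0)
    (hf : ∀ᶠ w : ℝ × ℝ in 𝓝 P, ∀ p : ℝ,
      edx (edx η) w.1 w.2 + 2 * p * edx (edy η) w.1 w.2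
        + p ^ 2 * edy (edy η) w.1 w.2 + edy η w.1 w.2 * f w.1 w.2 p = 0) (p : ℝ) :
    pdp (pdp (pdp f)) P.1 P.2 p = 0 ∧
      pdp (pdx f) P.1 P.2 p =
        - pdp (pdp f) P.1 P.2 p * f P.1 P.2 p + 2 * pdy f P.1 P.2 p
          + (1 / 2) * (pdp f P.1 P.2 p) ^ 2 - p * pdp (pdy f) P.1 P.2 p := by
  have hx := hη.edx
  have hu := hη.edy
  have hxx := hx.edx
  have hux := hu.edx
  have huy := hu.edy
  have hmul : ∀ {g : ℝ → ℝ → ℝ} (r : ℝ), AnalyticAt ℝ (fun w : ℝ × ℝ => g w.1 w.2) P →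
      AnalyticAt ℝ (fun w : ℝ × ℝ => r * g w.1 w.2 / edy η w.1 w.2) P := fun r hg =>
    (analyticAt_const.mul hg).div hu h0
  refine (quadratic_conditions_iff (a := fun x y => -1 * edx (edx η) x y / edy η x y)
    (b := fun x y => -2 * edx (edy η) x y / edy η x y)
    (c := fun x y => -1 * edy (edy η) x y / edy η x y)
    (hmul _ hxx) (hmul _ hux) (hmul _ huy) ?_).2 ⟨?_, ?_⟩ p
  · filter_upwards [hf, hu.continuousAt.eventually_ne h0] with w hw hw0 p
    field_simp
    linear_combination hw p
  · have e1 : edx (fun x y => -1 * edy (edy η) x y / edy η x y) P.1 P.2 = _ :=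
      (((hasDerivAt_edx huy).const_mul (-1)).div (hasDerivAt_edx hu) h0).deriv
    have e2 : edy (fun x y => -2 * edx (edy η) x y / edy η x y) P.1 P.2 = _ :=
      (((hasDerivAt_edy hux).const_mul (-2)).div (hasDerivAt_edy hu) h0).deriv
    rw [e1, e2, edx_edy_comm hu]
    field_simp
  · have e1 : edx (fun x y => -2 * edx (edy η) x y / edy η x y) P.1 P.2 = _ :=
      (((hasDerivAt_edx hux).const_mul (-2)).div (hasDerivAt_edx hu) h0).deriv
    have e2 : edy (fun x y => -1 * edx (edx η) x y / edy η x y) P.1 P.2 = _ :=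
      (((hasDerivAt_edy hxx).const_mul (-1)).div (hasDerivAt_edy hu) h0).deriv
    have e3 : edy (edx (edx η)) P.1 P.2 = edx (edx (edy η)) P.1 P.2 := by
      rw [← edx_edy_comm hx]
      exact edx_congr (hη.eventually_analyticAt.mono fun w hw => (edx_edy_comm hw).symm)
    rw [e1, e2, e3]
    field_simp
    ring

variable {a b c : ℝ → ℝ → ℝ}

theorem exists_flat_of_coefficients
    (ha : AnalyticAt ℝ (fun w : ℝ × ℝ => a w.1 w.2) P)
    (hb : AnalyticAt ℝ (fun w : ℝ × ℝ => b w.1 w.2) P)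
    (hc : AnalyticAt ℝ (fun w : ℝ × ℝ => c w.1 w.2) P)
    (hcb : ∀ᶠ w : ℝ × ℝ in 𝓝 P, 2 * edx c w.1 w.2 = edy b w.1 w.2)
    (hba : ∀ᶠ w : ℝ × ℝ in 𝓝 P, edx b w.1 w.2 =
      2 * edy a w.1 w.2 - 2 * a w.1 w.2 * c w.1 w.2 + b w.1 w.2 ^ 2 / 2) :
    ∃ η : ℝ → ℝ → ℝ, AnalyticAt ℝ (fun w : ℝ × ℝ => η w.1 w.2) P ∧
      (∀ᶠ w : ℝ × ℝ in 𝓝 P, edy η w.1 w.2 ≠ 0) ∧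
      ∀ᶠ w : ℝ × ℝ in 𝓝 P, ∀ p : ℝ,
        edx (edx η) w.1 w.2 + 2 * p * edx (edy η) w.1 w.2 + p ^ 2 * edy (edy η) w.1 w.2
          + edy η w.1 w.2 * (a w.1 w.2 + b w.1 w.2 * p + c w.1 w.2 * p ^ 2) = 0 := by
  have ea := ha.eventually_analyticAt
  have eb := hb.eventually_analyticAt
  have ec := hc.eventually_analyticAt
  obtain ⟨L, hL, hLx, hLy⟩ := exists_analyticAt_edx_eq_edy_eq
    (M := fun x y => -1 / 2 * b x y) (N := fun x y => -1 * c x y)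
    (analyticAt_const.mul hb) (analyticAt_const.mul hc) (by
      filter_upwards [eb, ec, hcb] with w hbw hcw hw
      have e1 : edy (fun x y => -1 / 2 * b x y) w.1 w.2 = _ :=
        ((hasDerivAt_edy hbw).const_mul (-1 / 2)).deriv
      have e2 : edx (fun x y => -1 * c x y) w.1 w.2 = _ :=
        ((hasDerivAt_edx hcw).const_mul (-1)).deriv
      rw [e1, e2]
      linear_combination hw / 2)
  obtain ⟨u, hu_def⟩ : ∃ u : ℝ → ℝ → ℝ, u = fun x y => Real.exp (L x y) := ⟨_, rfl⟩
  have hu : AnalyticAt ℝ (fun w : ℝ × ℝ => u w.1 w.2) P := by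
    rw [hu_def]
    exact hL.rexp
  have eu := hu.eventually_analyticAt
  have hux : ∀ᶠ w : ℝ × ℝ in 𝓝 P, edx u w.1 w.2 = -1 / 2 * b w.1 w.2 * u w.1 w.2 := by
    filter_upwards [hL.eventually_analyticAt, hLx] with w hLw hw
    have e1 : edx (fun x y => Real.exp (L x y)) w.1 w.2 = _ := (hasDerivAt_edx hLw).exp.deriv
    rw [hu_def, e1, hw]
    ring
  have huy : ∀ᶠ w : ℝ × ℝ in 𝓝 P, edy u w.1 w.2 = -c w.1 w.2 * u w.1 w.2 := by
    filter_upwards [hL.eventually_analyticAt, hLy] with w hLw hw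
    have e1 : edy (fun x y => Real.exp (L x y)) w.1 w.2 = _ := (hasDerivAt_edy hLw).exp.deriv
    rw [hu_def, e1, hw]
    ring
  obtain ⟨ξ, hξ, hξx, hξy⟩ := exists_analyticAt_edx_eq_edy_eq
    (M := fun x y => -1 * a x y * u x y) (N := fun x y => -1 / 2 * b x y * u x y)
    ((analyticAt_const.mul ha).mul hu) ((analyticAt_const.mul hb).mul hu) (by
      filter_upwards [ea, eb, eu, hux, huy, hba] with w haw hbw huw hx hy hw
      have e1 : edy (fun x y => -1 * a x y * u x y) w.1 w.2 = _ :=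
        (((hasDerivAt_edy haw).const_mul (-1)).mul (hasDerivAt_edy huw)).deriv
      have e2 : edx (fun x y => -1 / 2 * b x y * u x y) w.1 w.2 = _ :=
        (((hasDerivAt_edx hbw).const_mul (-1 / 2)).mul (hasDerivAt_edx huw)).deriv
      rw [e1, e2, hx, hy]
      linear_combination u w.1 w.2 / 2 * hw)
  obtain ⟨η, hη, hηx, hηy⟩ := exists_analyticAt_edx_eq_edy_eq (M := ξ) (N := u) hξ hu (by
    filter_upwards [hξy, hux] with w h1 h2
    rw [h1, h2])
  refine ⟨η, hη, ?_, ?_⟩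
  · filter_upwards [hηy] with w hw
    rw [hw, hu_def]
    exact (Real.exp_pos _).ne'
  · filter_upwards [hηx.eventually_nhds, hηy.eventually_nhds, hξx, hux, huy]
      with w hx hy h1 h2 h3 p
    rw [edx_congr hx, edx_congr hy, edy_congr hy, hy.self_of_nhds, h1, h2, h3]
    ring

end Flat

/-- For a real-analytic `f` on `Ω × ℝ` (`Ω ⊆ ℝ²` open connected), the
second-order ODE `y'' = f(x, y, y')` is locally reducible to `ȳ'' = 0` by transformations
`(x, y) ↦ (x + C, η(x, y))` (condition (a)) iff `f_ppp = 0` and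
`f_xp = -f_pp·f + 2·f_y + (1/2)·f_p² - p·f_yp` hold on `Ω × ℝ` (condition (b)). -/
theorem statement0
    (Ω : Set (ℝ × ℝ)) (hΩo : IsOpen Ω) (hΩc : IsConnected Ω)
    (f : ℝ → ℝ → ℝ → ℝ)
    (hf : AnalyticOnNhd ℝ (fun z : ℝ × ℝ × ℝ => f z.1 z.2.1 z.2.2)
      {z : ℝ × ℝ × ℝ | (z.1, z.2.1) ∈ Ω}) :
    (∀ P ∈ Ω, ∃ Ω' : Set (ℝ × ℝ),
        Ω' ⊆ Ω ∧ IsOpen Ω' ∧ IsConnected Ω' ∧ P ∈ Ω' ∧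
        ∃ η : ℝ → ℝ → ℝ,
          AnalyticOnNhd ℝ (fun w : ℝ × ℝ => η w.1 w.2) Ω' ∧
          (∀ w ∈ Ω', edy η w.1 w.2 ≠ 0) ∧
          (∀ w ∈ Ω', ∀ p : ℝ,
            edx (edx η) w.1 w.2 + 2 * p * edx (edy η) w.1 w.2
              + p ^ 2 * edy (edy η) w.1 w.2 + edy η w.1 w.2 * f w.1 w.2 p = 0))
    ↔
    (∀ w ∈ Ω, ∀ p : ℝ,
      pdp (pdp (pdp f)) w.1 w.2 p = 0 ∧
      pdp (pdx f) w.1 w.2 p =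
        - pdp (pdp f) w.1 w.2 p * f w.1 w.2 p + 2 * pdy f w.1 w.2 p
          + (1 / 2) * (pdp f w.1 w.2 p) ^ 2 - p * pdp (pdy f) w.1 w.2 p) := by
  constructor
  · intro h P hP
    obtain ⟨Ω', -, hΩ'o, -, hPΩ', η, hη, hη0, hflat⟩ := h P hP
    exact conditions_of_flat (hη P hPΩ') (hη0 P hPΩ')
      (eventually_of_mem (hΩ'o.mem_nhds hPΩ') hflat)
  · intro h P hP
    have hfw : ∀ w ∈ Ω, ∀ p : ℝ, AnalyticAt ℝ (fun w : ℝ × ℝ => f w.1 w.2 p) w :=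
      fun w hw p => AnalyticAt.comp (g := fun z : ℝ × ℝ × ℝ => f z.1 z.2.1 z.2.2)
        (f := fun w : ℝ × ℝ => (w.1, w.2, p)) (hf (w.1, w.2, p) hw)
        (analyticAt_fst.prod (analyticAt_snd.prod analyticAt_const))
    have hfp : ∀ w ∈ Ω, AnalyticOnNhd ℝ (f w.1 w.2) Set.univ :=
      fun w hw p _ => AnalyticAt.comp (g := fun z : ℝ × ℝ × ℝ => f z.1 z.2.1 z.2.2)
        (f := fun p : ℝ => (w.1, w.2, p)) (hf (w.1, w.2, p) hw) (by fun_prop)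
    let a : ℝ → ℝ → ℝ := fun x y => f x y 0
    let b : ℝ → ℝ → ℝ := fun x y => (f x y 1 - f x y (-1)) / 2
    let c : ℝ → ℝ → ℝ := fun x y => (f x y 1 + f x y (-1)) / 2 - f x y 0
    have ha : ∀ w ∈ Ω, AnalyticAt ℝ (fun w : ℝ × ℝ => a w.1 w.2) w := fun w hw => hfw w hw 0
    have hb : ∀ w ∈ Ω, AnalyticAt ℝ (fun w : ℝ × ℝ => b w.1 w.2) w := fun w hw =>
      ((hfw w hw 1).sub (hfw w hw (-1))).div_const
    have hc : ∀ w ∈ Ω, AnalyticAt ℝ (fun w : ℝ × ℝ => c w.1 w.2) w := fun w hw =>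
      ((hfw w hw 1).add (hfw w hw (-1))).div_const.sub (hfw w hw 0)
    have hquad : ∀ w ∈ Ω, ∀ p : ℝ,
        f w.1 w.2 p = a w.1 w.2 + b w.1 w.2 * p + c w.1 w.2 * p ^ 2 := fun w hw p =>
      eq_quadratic_of_deriv_deriv_deriv_eq_zero (hfp w hw) (fun q => (h w hw q).1) p
    have hcoeff := fun w hw => (quadratic_conditions_iff (ha w hw) (hb w hw) (hc w hw)
      (eventually_of_mem (hΩo.mem_nhds hw) hquad)).1 (h w hw)
    obtain ⟨η, hη, hη0, hflat⟩ := exists_flat_of_coefficients (ha P hP) (hb P hP) (hc P hP)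
      (eventually_of_mem (hΩo.mem_nhds hP) fun w hw => (hcoeff w hw).1)
      (eventually_of_mem (hΩo.mem_nhds hP) fun w hw => (hcoeff w hw).2)
    obtain ⟨ε, hε, hball⟩ := Metric.eventually_nhds_iff_ball.1
      ((hη.eventually_analyticAt.and (hη0.and hflat)).and (hΩo.mem_nhds hP))
    refine ⟨Metric.ball P ε, fun w hw => (hball w hw).2, Metric.isOpen_ball,
      (convex_ball P ε).isConnected (Metric.nonempty_ball.2 hε), Metric.mem_ball_self hε, η,
      fun w hw => (hball w hw).1.1, fun w hw => (hball w hw).1.2.1, fun w hw p => ?_⟩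
    rw [hquad w (hball w hw).2 p]
    exact (hball w hw).1.2.2 p
end

section
/- Let Ω ⊆ ℝ² be open and connected and let f : Ω × ℝ → ℝ be real-analytic. Then the following are equivalent: (a) for every point (x₀, y₀) ∈ Ω there exist an open connected neighborhood Ω' ⊆ Ω of (x₀, y₀), a constant C ∈ ℝ, and a real-analytic function η : Ω' → ℝ with ∂η/∂y ≠ 0 everywhere, such that for every C² solution y(x) of y'' = f(x, y, y') whose graph lies in Ω', the transformed curve x̄ ↦ ȳ given by (x̄, ȳ) = (x + C, η(x, y(x))) satisfies d²ȳ/dx̄² = 0 (equivalently, x ↦ η(x, y(x)) is affine); (b) f satisfies on Ω × ℝ the identities f_{ppp} = 0 and f_{xp} = −f_{pp}·f + 2·f_y + (1/2)·f_p² − p·f_{yp}. -/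
section Auxiliary

open Filter Topology

/-- A function whose Fréchet derivative is analytic is itself analytic. -/
theorem AnalyticAt.of_hasFDerivAt_s3 {E F : Type*} [NormedAddCommGroup E] [NormedSpace ℝ E]
    [NormedAddCommGroup F] [NormedSpace ℝ F] [CompleteSpace F] {h : E → F} {ω : E → E →L[ℝ] F}
    {x : E} (hω : AnalyticAt ℝ ω x) (hh : ∀ᶠ y in 𝓝 x, HasFDerivAt h (ω y) y) :
    AnalyticAt ℝ h x := by
  obtain ⟨q, r, hq⟩ := hω
  obtain ⟨ε, hε, hball⟩ := Metric.eventually_nhds_iff_ball.1 hh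
  let q' : FormalMultilinearSeries ℝ E (E →L[ℝ] F) := fun n => ((n : ℝ) + 1)⁻¹ • q n
  have hinv : ∀ n : ℕ, ‖((n : ℝ) + 1)⁻¹‖ ≤ 1 := fun n => by
    rw [Real.norm_of_nonneg (by positivity)]
    exact inv_le_one_of_one_le₀ (by linarith [n.cast_nonneg (α := ℝ)])
  have hrad : q.radius ≤ q'.radius := by
    refine FormalMultilinearSeries.radius_le_of_le fun n => ?_
    calc ‖q' n‖ ≤ ‖((n : ℝ) + 1)⁻¹‖ * ‖q n‖ := ContinuousMultilinearMap.opNorm_smul_le _ _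
      _ ≤ ‖q n‖ := mul_le_of_le_one_left (norm_nonneg _) (hinv n)
  have hq' : HasFPowerSeriesOnBall q'.sum q' 0 q'.radius :=
    q'.hasFPowerSeriesOnBall (hq.r_pos.trans_le (hq.r_le.trans hrad))
  have key : ∀ᶠ y in 𝓝 (0 : E), h (x + y) = h x + q'.sum y y := by
    filter_upwards [Metric.ball_mem_nhds (0 : E) hε, Metric.eball_mem_nhds (0 : E) hq.r_pos]
      with y hy hyr
    have hty : ∀ t ∈ Set.Icc (0 : ℝ) 1, t • y ∈ Metric.eball (0 : E) r := fun t ht => by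
      rw [mem_eball_zero_iff] at hyr ⊢
      refine lt_of_le_of_lt ?_ hyr
      rw [enorm_smul]
      refine mul_le_of_le_one_left' ?_
      rw [← ofReal_norm, Real.norm_of_nonneg ht.1]
      exact ENNReal.ofReal_le_one.2 ht.2
    have hyq : y ∈ Metric.eball (0 : E) q.radius := Metric.eball_subset_eball hq.r_le hyr
    have hd : ∀ t ∈ Set.Icc (0 : ℝ) 1,
        HasDerivAt (fun t : ℝ => h (x + t • y)) (ω (x + t • y) y) t := fun t ht => by
      have h1 : HasFDerivAt h (ω (x + t • y)) (x + t • y) := by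
        apply hball
        simp only [Metric.mem_ball, dist_self_add_left, norm_smul, dist_zero_right] at hy ⊢
        rw [Real.norm_of_nonneg ht.1]
        exact (mul_le_of_le_one_left (norm_nonneg _) ht.2).trans_lt hy
      have h2 : HasDerivAt (fun t : ℝ => x + t • y) y t := by
        simpa using ((hasDerivAt_id t).smul_const y).const_add x
      exact h1.comp_hasDerivAt t h2
    have hI : Set.uIcc (0 : ℝ) 1 = Set.Icc 0 1 := Set.uIcc_of_le zero_le_one
    have hcont : ContinuousOn (fun t : ℝ => ω (x + t • y) y) (Set.Icc 0 1) := by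
      have h3 : ContinuousOn (fun t : ℝ => ω (x + t • y)) (Set.Icc 0 1) := by
        refine hq.continuousOn.comp (by fun_prop) fun t ht => ?_
        have := hty t ht
        rw [mem_eball_zero_iff] at this
        simpa [Metric.mem_eball, edist_eq_enorm_sub] using this
      exact h3.clm_apply continuousOn_const
    have hint : ∫ t in (0 : ℝ)..1, ω (x + t • y) y = h (x + y) - h x := by
      rw [intervalIntegral.integral_eq_sub_of_hasDerivAt (f := fun t : ℝ => h (x + t • y))
        (fun t ht => hd t (hI ▸ ht)) (hI ▸ hcont).intervalIntegrable]
      simp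
    have happ : ∀ (n : ℕ) (t : ℝ), (q n fun _ => t • y) = t ^ n • q n fun _ => y := fun n t => by
      simpa using (q n).map_smul_univ (fun _ => t) fun _ => y
    have hev : ∀ {u : ℕ → E →L[ℝ] F} {a : E →L[ℝ] F}, HasSum u a →
        HasSum (fun n => u n y) (a y) := fun hu => hu.mapL (ContinuousLinearMap.apply ℝ F y)
    have hs1 : HasSum (fun n : ℕ => ∫ t in (0 : ℝ)..1, (t ^ n • q n fun _ => y) y)
        (∫ t in (0 : ℝ)..1, ω (x + t • y) y) := by
      refine intervalIntegral.hasSum_integral_of_dominated_convergence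
        (fun n _ => ‖q n fun _ => y‖ * ‖y‖) (fun n => ?_) (fun n => .of_forall fun t ht => ?_)
        (.of_forall fun t _ => (q.summable_norm_apply hyq).mul_right _) (by simp)
        (.of_forall fun t ht => ?_)
      · exact Continuous.aestronglyMeasurable (by simp only [smul_apply]; fun_prop)
      · rw [Set.uIoc_of_le zero_le_one] at ht
        refine (ContinuousLinearMap.le_opNorm _ _).trans ?_
        gcongr
        rw [norm_smul, norm_pow, Real.norm_of_nonneg ht.1.le]
        exact mul_le_of_le_one_left (norm_nonneg _) (pow_le_one₀ ht.1.le ht.2)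
      · rw [Set.uIoc_of_le zero_le_one] at ht
        have := hq.hasSum (hty t (Set.Ioc_subset_Icc_self ht))
        simp only [happ] at this
        exact hev this
    have hs2 : HasSum (fun n : ℕ => (q' n fun _ => y) y) (q'.sum y y) :=
      hev
        (by simpa using hq'.hasSum (Metric.eball_subset_eball hrad hyq))
    have hterm : ∀ n : ℕ, ∫ t in (0 : ℝ)..1, (t ^ n • q n fun _ => y) y = (q' n fun _ => y) y := by
      intro n
      simp only [smul_apply, q']
      rw [intervalIntegral.integral_smul_const, integral_pow]
      simp
    simp only [hterm] at hs1
    have := hs1.unique hs2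
    rw [hint] at this
    rw [← this]; abel
  have han : AnalyticAt ℝ (fun y : E => h x + q'.sum y y) 0 :=
    analyticAt_const.add (AnalyticAt.comp₂ (f := fun y => q'.sum y) (g := fun y : E => y)
      ((ContinuousLinearMap.id ℝ (E →L[ℝ] F)).analyticAt_bilinear _) hq'.analyticAt analyticAt_id)
  have h0 : AnalyticAt ℝ (fun y => h (x + y)) 0 := han.congr (key.mono fun y hy => hy.symm)
  have h1 : AnalyticAt ℝ (fun y => h (x + (y - x))) x :=
    AnalyticAt.fun_comp (f := fun y => y - x) (g := fun y => h (x + y)) (by simpa using h0)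
      (by fun_prop)
  simpa using h1

/-- Joint real-analyticity on `U` of a curried function of two real variables. -/
def AnalyticPlane (g : ℝ → ℝ → ℝ) (U : Set (ℝ × ℝ)) : Prop :=
  AnalyticOnNhd ℝ (fun w : ℝ × ℝ => g w.1 w.2) U

namespace AnalyticPlane

variable {g P Q : ℝ → ℝ → ℝ} {U : Set (ℝ × ℝ)} {x y : ℝ}

theorem hasFDerivAt (hg : AnalyticPlane g U) (h : (x, y) ∈ U) :
    HasFDerivAt (fun w : ℝ × ℝ => g w.1 w.2)
      (fderiv ℝ (fun w : ℝ × ℝ => g w.1 w.2) (x, y)) (x, y) :=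
  (hg (x, y) h).differentiableAt.hasFDerivAt

theorem edx_eq (hg : AnalyticPlane g U) (h : (x, y) ∈ U) :
    edx g x y = fderiv ℝ (fun w : ℝ × ℝ => g w.1 w.2) (x, y) (1, 0) :=
  (HasFDerivAt.comp_hasDerivAt x (f := fun t : ℝ => (t, y)) (hg.hasFDerivAt h)
    ((hasDerivAt_id x).prodMk (hasDerivAt_const x y))).deriv

theorem edy_eq (hg : AnalyticPlane g U) (h : (x, y) ∈ U) :
    edy g x y = fderiv ℝ (fun w : ℝ × ℝ => g w.1 w.2) (x, y) (0, 1) :=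
  (HasFDerivAt.comp_hasDerivAt y (f := fun t : ℝ => (x, t)) (hg.hasFDerivAt h)
    ((hasDerivAt_const y x).prodMk (hasDerivAt_id y))).deriv

/-- The chain rule along a curve in the plane. -/
theorem hasDerivAt_comp (hg : AnalyticPlane g U) {u v : ℝ → ℝ} {u' v' t : ℝ} (h : (u t, v t) ∈ U)
    (hu : HasDerivAt u u' t) (hv : HasDerivAt v v' t) :
    HasDerivAt (fun s => g (u s) (v s)) (edx g (u t) (v t) * u' + edy g (u t) (v t) * v') t := by
  have := HasFDerivAt.comp_hasDerivAt t (f := fun s => (u s, v s)) (hg.hasFDerivAt h)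
    (hu.prodMk hv)
  refine this.congr_deriv ?_
  rw [hg.edx_eq h, hg.edy_eq h]
  have h2 : (u', v') = u' • ((1 : ℝ), (0 : ℝ)) + v' • ((0 : ℝ), (1 : ℝ)) := by simp
  rw [h2, map_add, map_smul, map_smul, smul_eq_mul, smul_eq_mul]
  ring

theorem hasDerivAt_edx (hg : AnalyticPlane g U) (h : (x, y) ∈ U) :
    HasDerivAt (fun t => g t y) (edx g x y) x := by
  simpa using hg.hasDerivAt_comp (u := fun t => t) (v := fun _ => y) h (hasDerivAt_id x)
    (hasDerivAt_const x y)

theorem hasDerivAt_edy (hg : AnalyticPlane g U) (h : (x, y) ∈ U) :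
    HasDerivAt (fun t => g x t) (edy g x y) y := by
  simpa using hg.hasDerivAt_comp (u := fun _ => x) (v := fun t => t) h (hasDerivAt_const y x)
    (hasDerivAt_id y)

theorem partial_fst (hg : AnalyticPlane g U) (hU : IsOpen U) : AnalyticPlane (edx g) U :=
  AnalyticOnNhd.congr hU
    ((ContinuousLinearMap.apply ℝ ℝ ((1 : ℝ), (0 : ℝ))).comp_analyticOnNhd
      (AnalyticOnNhd.fderiv hg)) fun _ hw => (hg.edx_eq hw).symm

theorem partial_snd (hg : AnalyticPlane g U) (hU : IsOpen U) : AnalyticPlane (edy g) U :=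
  AnalyticOnNhd.congr hU
    ((ContinuousLinearMap.apply ℝ ℝ ((0 : ℝ), (1 : ℝ))).comp_analyticOnNhd
      (AnalyticOnNhd.fderiv hg)) fun _ hw => (hg.edy_eq hw).symm

theorem eventually_fst (hU : IsOpen U) (h : (x, y) ∈ U) : ∀ᶠ t in 𝓝 x, (t, y) ∈ U :=
  ContinuousAt.eventually_mem (f := fun t : ℝ => (t, y)) (by fun_prop) (hU.mem_nhds h)

theorem eventually_snd (hU : IsOpen U) (h : (x, y) ∈ U) : ∀ᶠ t in 𝓝 y, (x, t) ∈ U :=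
  ContinuousAt.eventually_mem (f := fun t : ℝ => (x, t)) (by fun_prop) (hU.mem_nhds h)

theorem edx_congr (hU : IsOpen U) (h : (x, y) ∈ U) (hPQ : ∀ x y, (x, y) ∈ U → P x y = Q x y) :
    edx P x y = edx Q x y :=
  Filter.EventuallyEq.deriv_eq ((eventually_fst hU h).mono fun _ ht => hPQ _ _ ht)

theorem edy_congr (hU : IsOpen U) (h : (x, y) ∈ U) (hPQ : ∀ x y, (x, y) ∈ U → P x y = Q x y) :
    edy P x y = edy Q x y :=
  Filter.EventuallyEq.deriv_eq ((eventually_snd hU h).mono fun _ ht => hPQ _ _ ht)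

theorem edx_edy_comm (hg : AnalyticPlane g U) (hU : IsOpen U) (h : (x, y) ∈ U) :
    edx (edy g) x y = edy (edx g) x y := by
  set G := fun w : ℝ × ℝ => g w.1 w.2 with hG
  have hd : HasFDerivAt (fderiv ℝ G) (fderiv ℝ (fderiv ℝ G) (x, y)) (x, y) :=
    (AnalyticOnNhd.fderiv hg (x, y) h).differentiableAt.hasFDerivAt
  have hx : HasDerivAt (fun t => fderiv ℝ G (t, y) (0, 1))
      (fderiv ℝ (fderiv ℝ G) (x, y) (1, 0) (0, 1)) x :=
    (ContinuousLinearMap.apply ℝ ℝ ((0 : ℝ), (1 : ℝ))).hasFDerivAt.comp_hasDerivAt x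
      (hd.comp_hasDerivAt x (f := fun t : ℝ => (t, y))
        ((hasDerivAt_id x).prodMk (hasDerivAt_const x y)))
  have hy : HasDerivAt (fun t => fderiv ℝ G (x, t) (1, 0))
      (fderiv ℝ (fderiv ℝ G) (x, y) (0, 1) (1, 0)) y :=
    (ContinuousLinearMap.apply ℝ ℝ ((1 : ℝ), (0 : ℝ))).hasFDerivAt.comp_hasDerivAt y
      (hd.comp_hasDerivAt y (f := fun t : ℝ => (x, t))
        ((hasDerivAt_const y x).prodMk (hasDerivAt_id y)))
  have hsym : IsSymmSndFDerivAt ℝ G (x, y) := by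
    refine ContDiffAt.isSymmSndFDerivAt (n := 2) (hg (x, y) h).contDiffAt ?_
    simp [minSmoothness_of_isRCLikeNormedField]
  calc edx (edy g) x y = edx (fun x y => fderiv ℝ G (x, y) (0, 1)) x y :=
        edx_congr hU h fun a b hab => hg.edy_eq hab
    _ = fderiv ℝ (fderiv ℝ G) (x, y) (1, 0) (0, 1) := hx.deriv
    _ = fderiv ℝ (fderiv ℝ G) (x, y) (0, 1) (1, 0) := hsym _ _
    _ = edy (fun x y => fderiv ℝ G (x, y) (1, 0)) x y := hy.deriv.symm
    _ = edy (edx g) x y := (edy_congr hU h fun a b hab => hg.edx_eq hab).symm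

/-- The Poincaré lemma for real-analytic closed one-forms on a convex open subset of the plane. -/
theorem exists_primitive (hU : IsOpen U) (hc : Convex ℝ U) (hP : AnalyticPlane P U)
    (hQ : AnalyticPlane Q U)
    (hPQ : ∀ x y, (x, y) ∈ U → edy P x y = edx Q x y) :
    ∃ h : ℝ → ℝ → ℝ, AnalyticPlane h U ∧
      ∀ x y, (x, y) ∈ U → edx h x y = P x y ∧ edy h x y = Q x y := by
  let ω : ℝ × ℝ → (ℝ × ℝ) →L[ℝ] ℝ := fun w =>
    P w.1 w.2 • ContinuousLinearMap.fst ℝ ℝ ℝ + Q w.1 w.2 • ContinuousLinearMap.snd ℝ ℝ ℝ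
  have hω : AnalyticOnNhd ℝ ω U := fun w hw =>
    ((hP w hw).smul analyticAt_const).add ((hQ w hw).smul analyticAt_const)
  have hdω : ∀ a ∈ U, ∀ v w, fderiv ℝ ω a v w = fderiv ℝ ω a w v := by
    rintro ⟨x, y⟩ hxy ⟨v₁, v₂⟩ ⟨w₁, w₂⟩
    have hd := ((hP.hasFDerivAt hxy).smul_const (ContinuousLinearMap.fst ℝ ℝ ℝ)).fun_add
      ((hQ.hasFDerivAt hxy).smul_const (ContinuousLinearMap.snd ℝ ℝ ℝ))
    have hlin : ∀ (L : (ℝ × ℝ) →L[ℝ] ℝ) (a b : ℝ), L (a, b) = a * L (1, 0) + b * L (0, 1) := by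
      intro L a b
      have h2 : (a, b) = a • ((1 : ℝ), (0 : ℝ)) + b • ((0 : ℝ), (1 : ℝ)) := by simp
      rw [h2, map_add, map_smul, map_smul, smul_eq_mul, smul_eq_mul]
    have hcl := hPQ x y hxy
    rw [hP.edy_eq hxy, hQ.edx_eq hxy] at hcl
    rw [show fderiv ℝ ω (x, y) = _ from hd.fderiv]
    simp only [add_apply, ContinuousLinearMap.smulRight_apply, smul_apply,
      ContinuousLinearMap.coe_fst', ContinuousLinearMap.coe_snd', smul_eq_mul]
    rw [hlin _ v₁ v₂, hlin _ w₁ w₂, hlin (fderiv ℝ (fun w : ℝ × ℝ => Q w.1 w.2) _) v₁ v₂,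
      hlin (fderiv ℝ (fun w : ℝ × ℝ => Q w.1 w.2) _) w₁ w₂, hcl]
    ring
  obtain ⟨h, hh⟩ := hc.exists_forall_hasFDerivAt_of_fderiv_symmetric hU
    (fun w hw => (hω w hw).differentiableAt.differentiableWithinAt) hdω
  have han : AnalyticPlane (fun x y => h (x, y)) U := fun w hw =>
    AnalyticAt.of_hasFDerivAt_s3 (hω w hw) (Filter.eventually_of_mem (hU.mem_nhds hw) hh)
  refine ⟨fun x y => h (x, y), han, fun x y hxy => ?_⟩
  rw [han.edx_eq hxy, han.edy_eq hxy]
  have : fderiv ℝ (fun w : ℝ × ℝ => h (w.1, w.2)) (x, y) = ω (x, y) := (hh _ hxy).fderiv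
  simp [this, ω]

end AnalyticPlane

/-- For `f` quadratic in `p`, the two differential identities amount to two identities between
its coefficients. -/
theorem pdp_conditions_iff_of_quadratic {f : ℝ → ℝ → ℝ → ℝ} {A B D : ℝ → ℝ → ℝ}
    {U : Set (ℝ × ℝ)} (hU : IsOpen U)
    (hA : AnalyticPlane A U) (hB : AnalyticPlane B U) (hD : AnalyticPlane D U)
    (hf : ∀ x y, (x, y) ∈ U → ∀ p, f x y p = A x y + B x y * p + D x y * p ^ 2)
    {x y : ℝ} (h : (x, y) ∈ U) :
    (∀ p : ℝ, pdp (pdp (pdp f)) x y p = 0 ∧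
      pdp (pdx f) x y p =
        - pdp (pdp f) x y p * f x y p + 2 * pdy f x y p
          + (1 / 2) * (pdp f x y p) ^ 2 - p * pdp (pdy f) x y p) ↔
    edy B x y = 2 * edx D x y ∧
      edx B x y = 2 * edy A x y - 2 * D x y * A x y + B x y ^ 2 / 2 := by
  have hquad : ∀ a b c p : ℝ, HasDerivAt (fun t : ℝ => a + b * t + c * t ^ 2) (b + 2 * c * p) p :=
    fun a b c p => by
      have := (((hasDerivAt_id p).const_mul b).const_add a).add
        (((hasDerivAt_id p).pow 2).const_mul c)
      exact (this.congr_deriv (by simp; ring)).congr_of_eventuallyEq (.of_forall fun t => by simp)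
  have hlin : ∀ b c p : ℝ, HasDerivAt (fun t : ℝ => b + 2 * c * t) (2 * c) p := fun b c p => by
    simpa using ((hasDerivAt_id p).const_mul (2 * c)).const_add b
  have h1 : ∀ p, pdp f x y p = B x y + 2 * D x y * p := fun p => by
    simp only [pdp, hf x y h]
    exact (hquad _ _ _ p).deriv
  have h2 : ∀ p, pdp (pdp f) x y p = 2 * D x y := fun p => by
    have : pdp f x y = fun t => B x y + 2 * D x y * t := funext h1
    change deriv (pdp f x y) p = _
    rw [this]
    exact (hlin _ _ p).deriv
  have h3 : ∀ p, pdp (pdp (pdp f)) x y p = 0 := fun p => by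
    have : pdp (pdp f) x y = fun _ => 2 * D x y := funext h2
    change deriv (pdp (pdp f) x y) p = _
    rw [this, deriv_const]
  have hx : pdx f x y = fun p => edx A x y + edx B x y * p + edx D x y * p ^ 2 := funext fun p => by
    have hev : (fun t => f t y p) =ᶠ[𝓝 x] fun t => A t y + B t y * p + D t y * p ^ 2 :=
      (AnalyticPlane.eventually_fst hU h).mono fun t ht => hf t y ht p
    exact hev.deriv_eq.trans (((hA.hasDerivAt_edx h).add ((hB.hasDerivAt_edx h).mul_const p)).add
      ((hD.hasDerivAt_edx h).mul_const _)).deriv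
  have hy : pdy f x y = fun p => edy A x y + edy B x y * p + edy D x y * p ^ 2 := funext fun p => by
    have hev : (fun t => f x t p) =ᶠ[𝓝 y] fun t => A x t + B x t * p + D x t * p ^ 2 :=
      (AnalyticPlane.eventually_snd hU h).mono fun t ht => hf x t ht p
    exact hev.deriv_eq.trans (((hA.hasDerivAt_edy h).add ((hB.hasDerivAt_edy h).mul_const p)).add
      ((hD.hasDerivAt_edy h).mul_const _)).deriv
  have hxp : ∀ p, pdp (pdx f) x y p = edx B x y + 2 * edx D x y * p := fun p => by
    change deriv (pdx f x y) p = _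
    rw [hx]
    exact (hquad _ _ _ p).deriv
  have hyp : ∀ p, pdp (pdy f) x y p = edy B x y + 2 * edy D x y * p := fun p => by
    change deriv (pdy f x y) p = _
    rw [hy]
    exact (hquad _ _ _ p).deriv
  simp only [h1, h2, h3, hxp, hyp, hy, hf x y h, true_and]
  constructor
  · intro H
    have H0 := H 0
    have H1 := H 1
    exact ⟨by linear_combination H0 - H1, by linear_combination H0⟩
  · rintro ⟨H1, H2⟩ p
    linear_combination H2 - p * H1

/-- A twice differentiable function on `ℝ` with vanishing third derivative is quadratic. -/
theorem eq_quadratic_of_deriv_deriv_deriv_eq_zero_s3 {g : ℝ → ℝ} (h0 : Differentiable ℝ g)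
    (h1 : Differentiable ℝ (deriv g)) (h2 : Differentiable ℝ (deriv (deriv g)))
    (h3 : ∀ p, deriv (deriv (deriv g)) p = 0) (p : ℝ) :
    g p = g 0 + deriv g 0 * p + deriv (deriv g) 0 / 2 * p ^ 2 := by
  have c2 : ∀ p, deriv (deriv g) p = deriv (deriv g) 0 := fun p =>
    is_const_of_deriv_eq_zero h2 h3 p 0
  have c1 : ∀ p, deriv g p = deriv g 0 + deriv (deriv g) 0 * p := fun p => by
    have hd : ∀ t, HasDerivAt (fun t => deriv g t - deriv (deriv g) 0 * t) 0 t := fun t => by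
      simpa [c2 t] using (h1 t).hasDerivAt.fun_sub ((hasDerivAt_id t).const_mul (deriv (deriv g) 0))
    have := is_const_of_deriv_eq_zero (fun t => (hd t).differentiableAt) (fun t => (hd t).deriv) p 0
    simp only [mul_zero, sub_zero] at this
    linarith
  have hd : ∀ t, HasDerivAt (fun t => g t - deriv g 0 * t - deriv (deriv g) 0 / 2 * t ^ 2) 0 t :=
    fun t => by
      have := ((h0 t).hasDerivAt.sub ((hasDerivAt_id t).const_mul (deriv g 0))).sub
        (((hasDerivAt_id t).pow 2).const_mul (deriv (deriv g) 0 / 2))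
      refine (this.congr_deriv ?_).congr_of_eventuallyEq (.of_forall fun t => by simp)
      simp [c1 t]; ring
  have := is_const_of_deriv_eq_zero (fun t => (hd t).differentiableAt) (fun t => (hd t).deriv) p 0
  simp only [mul_zero, sub_zero, ne_eq, OfNat.ofNat_ne_zero, not_false_eq_true, zero_pow] at this
  linarith

/-- The partial derivative in `p` of an analytic function on an open set is analytic. -/
theorem AnalyticOnNhd.pdp {f : ℝ → ℝ → ℝ → ℝ} {S : Set (ℝ × ℝ × ℝ)} (hS : IsOpen S)
    (hf : AnalyticOnNhd ℝ (fun z : ℝ × ℝ × ℝ => f z.1 z.2.1 z.2.2) S) :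
    AnalyticOnNhd ℝ (fun z : ℝ × ℝ × ℝ => pdp f z.1 z.2.1 z.2.2) S := by
  refine AnalyticOnNhd.congr hS
    ((ContinuousLinearMap.apply ℝ ℝ ((0 : ℝ), (0 : ℝ), (1 : ℝ))).comp_analyticOnNhd
      (AnalyticOnNhd.fderiv hf)) ?_
  rintro ⟨x, y, p⟩ hz
  exact (HasFDerivAt.comp_hasDerivAt p (f := fun t : ℝ => (x, y, t))
    (hf _ hz).differentiableAt.hasFDerivAt
    ((hasDerivAt_const p x).prodMk ((hasDerivAt_const p y).prodMk (hasDerivAt_id p)))).deriv.symm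

/-- Local solvability of the initial value problem for `y'' = f(x, y, y')`. -/
theorem exists_solution_of_analytic {f : ℝ → ℝ → ℝ → ℝ} {U : Set (ℝ × ℝ)} (hU : IsOpen U)
    (hf : AnalyticOnNhd ℝ (fun z : ℝ × ℝ × ℝ => f z.1 z.2.1 z.2.2)
      {z : ℝ × ℝ × ℝ | (z.1, z.2.1) ∈ U})
    {x₀ y₀ : ℝ} (h : (x₀, y₀) ∈ U) (p₀ : ℝ) :
    ∃ ε > 0, ∃ y : ℝ → ℝ, y x₀ = y₀ ∧ deriv y x₀ = p₀ ∧
      (∀ x ∈ Set.Ioo (x₀ - ε) (x₀ + ε), (x, y x) ∈ U) ∧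
      ContDiffOn ℝ 2 y (Set.Ioo (x₀ - ε) (x₀ + ε)) ∧
      ∀ x ∈ Set.Ioo (x₀ - ε) (x₀ + ε), deriv (deriv y) x = f x (y x) (deriv y x) := by
  let V : ℝ × ℝ × ℝ → ℝ × ℝ × ℝ := fun z => (1, z.2.2, f z.1 z.2.1 z.2.2)
  have hV : ContDiffAt ℝ 1 V (x₀, y₀, p₀) :=
    contDiffAt_const.prodMk ((by fun_prop : ContDiffAt ℝ 1 (fun z : ℝ × ℝ × ℝ => z.2.2) _).prodMk
      (hf (x₀, y₀, p₀) h).contDiffAt)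
  obtain ⟨α, hα0, ε₀, hε₀, hα⟩ :=
    hV.exists_forall_mem_closedBall_exists_eq_forall_mem_Ioo_hasDerivAt₀ x₀
  have h1 : ∀ t ∈ Set.Ioo (x₀ - ε₀) (x₀ + ε₀), HasDerivAt (fun t => (α t).1) 1 t := fun t ht =>
    (ContinuousLinearMap.fst ℝ ℝ (ℝ × ℝ)).hasFDerivAt.comp_hasDerivAt t (hα t ht)
  have h2 : ∀ t ∈ Set.Ioo (x₀ - ε₀) (x₀ + ε₀), HasDerivAt (fun t => (α t).2) (V (α t)).2 t :=
    fun t ht => (ContinuousLinearMap.snd ℝ ℝ (ℝ × ℝ)).hasFDerivAt.comp_hasDerivAt t (hα t ht)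
  have h21 : ∀ t ∈ Set.Ioo (x₀ - ε₀) (x₀ + ε₀), HasDerivAt (fun t => (α t).2.1) (α t).2.2 t :=
    fun t ht => (ContinuousLinearMap.fst ℝ ℝ ℝ).hasFDerivAt.comp_hasDerivAt t (h2 t ht)
  have h22 : ∀ t ∈ Set.Ioo (x₀ - ε₀) (x₀ + ε₀),
      HasDerivAt (fun t => (α t).2.2) (f (α t).1 (α t).2.1 (α t).2.2) t :=
    fun t ht => (ContinuousLinearMap.snd ℝ ℝ ℝ).hasFDerivAt.comp_hasDerivAt t (h2 t ht)
  have hx₀ : x₀ ∈ Set.Ioo (x₀ - ε₀) (x₀ + ε₀) := by constructor <;> linarith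
  have hfst : ∀ t ∈ Set.Ioo (x₀ - ε₀) (x₀ + ε₀), (α t).1 = t := fun t ht => by
    have hd : ∀ s ∈ Set.Ioo (x₀ - ε₀) (x₀ + ε₀), HasDerivAt (fun t => (α t).1 - t) 0 s :=
      fun s hs => by simpa using (h1 s hs).fun_sub (hasDerivAt_id' s)
    have := isOpen_Ioo.is_const_of_deriv_eq_zero isPreconnected_Ioo
      (fun s hs => (hd s hs).differentiableAt.differentiableWithinAt)
      (fun s hs => (hd s hs).deriv) ht hx₀
    simp only [hα0, sub_self] at this
    linarith
  have hmem : ∀ᶠ t in 𝓝 x₀, (t, (α t).2.1) ∈ U := by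
    refine ContinuousAt.eventually_mem (f := fun t : ℝ => (t, (α t).2.1))
      (continuousAt_id.prodMk (h21 x₀ hx₀).continuousAt) (hU.mem_nhds ?_)
    simpa [hα0] using h
  obtain ⟨δ, hδ, hball⟩ := Metric.eventually_nhds_iff_ball.1 hmem
  rw [Real.ball_eq_Ioo] at hball
  have hsub : Set.Ioo (x₀ - min ε₀ δ) (x₀ + min ε₀ δ) ⊆ Set.Ioo (x₀ - ε₀) (x₀ + ε₀) :=
    Set.Ioo_subset_Ioo (by linarith [min_le_left ε₀ δ]) (by linarith [min_le_left ε₀ δ])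
  have hsub' : Set.Ioo (x₀ - min ε₀ δ) (x₀ + min ε₀ δ) ⊆ Set.Ioo (x₀ - δ) (x₀ + δ) :=
    Set.Ioo_subset_Ioo (by linarith [min_le_right ε₀ δ]) (by linarith [min_le_right ε₀ δ])
  have hderiv : ∀ t ∈ Set.Ioo (x₀ - ε₀) (x₀ + ε₀), deriv (fun t => (α t).2.1) t = (α t).2.2 :=
    fun t ht => (h21 t ht).deriv
  have h2' : ∀ t ∈ Set.Ioo (x₀ - ε₀) (x₀ + ε₀), HasDerivAt (deriv fun t => (α t).2.1)
      (f t (α t).2.1 (α t).2.2) t := fun t ht => by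
    have := (h22 t ht).congr_of_eventuallyEq
      (Filter.eventually_of_mem (isOpen_Ioo.mem_nhds ht) hderiv)
    rwa [hfst t ht] at this
  refine ⟨min ε₀ δ, lt_min hε₀ hδ, fun t => (α t).2.1, by simp [hα0], by simp [hderiv x₀ hx₀, hα0],
    fun t ht => hball t (hsub' ht), ?_, fun t ht => ?_⟩
  · rw [show (2 : WithTop ℕ∞) = 1 + 1 by norm_num,
      contDiffOn_succ_iff_deriv_of_isOpen isOpen_Ioo]
    refine ⟨fun t ht => (h21 t (hsub ht)).differentiableAt.differentiableWithinAt, by simp, ?_⟩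
    rw [show (1 : WithTop ℕ∞) = 0 + 1 by norm_num,
      contDiffOn_succ_iff_deriv_of_isOpen isOpen_Ioo]
    refine ⟨fun t ht => (h2' t (hsub ht)).differentiableAt.differentiableWithinAt, by simp, ?_⟩
    rw [contDiffOn_zero]
    have hc : ContinuousOn (fun t => f t (α t).2.1 (α t).2.2)
        (Set.Ioo (x₀ - min ε₀ δ) (x₀ + min ε₀ δ)) := fun t ht => by
      have hz : (t, (α t).2.1, (α t).2.2) ∈ {z : ℝ × ℝ × ℝ | (z.1, z.2.1) ∈ U} := hball t (hsub' ht)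
      exact (ContinuousAt.comp (f := fun t => (t, (α t).2.1, (α t).2.2)) (hf _ hz).continuousAt
        (continuousAt_id.prodMk ((h21 t (hsub ht)).continuousAt.prodMk
          (h22 t (hsub ht)).continuousAt))).continuousWithinAt
    exact hc.congr fun t ht => (h2' t (hsub ht)).deriv
  · rw [(h2' t (hsub ht)).deriv, hderiv t (hsub ht)]

/-- The second derivative of `x ↦ η(x, y(x))`. -/
theorem AnalyticPlane.deriv_deriv_comp {η : ℝ → ℝ → ℝ} {U : Set (ℝ × ℝ)} (hU : IsOpen U)
    (hη : AnalyticPlane η U) {a b : ℝ} {y : ℝ → ℝ} (hy : ∀ x ∈ Set.Ioo a b, (x, y x) ∈ U)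
    (hc : ContDiffOn ℝ 2 y (Set.Ioo a b)) {x : ℝ} (hx : x ∈ Set.Ioo a b) :
    deriv (deriv (fun t => η t (y t))) x =
      edx (edx η) x (y x) + 2 * edx (edy η) x (y x) * deriv y x +
        edy (edy η) x (y x) * deriv y x ^ 2 +
        edy η x (y x) * deriv (deriv y) x := by
  rw [show (2 : WithTop ℕ∞) = 1 + 1 by norm_num,
    contDiffOn_succ_iff_deriv_of_isOpen isOpen_Ioo] at hc
  have h1 : ∀ t ∈ Set.Ioo a b, HasDerivAt y (deriv y t) t := fun t ht =>
    (hc.1.differentiableAt (isOpen_Ioo.mem_nhds ht)).hasDerivAt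
  have h2 : HasDerivAt (deriv y) (deriv (deriv y) x) x :=
    ((hc.2.2.differentiableOn one_ne_zero).differentiableAt (isOpen_Ioo.mem_nhds hx)).hasDerivAt
  have hd : ∀ t ∈ Set.Ioo a b, deriv (fun t => η t (y t)) t =
      edx η t (y t) + edy η t (y t) * deriv y t := fun t ht => by
    simpa using (hη.hasDerivAt_comp (u := fun s => s) (hy t ht) (hasDerivAt_id t) (h1 t ht)).deriv
  have hev := Filter.eventually_of_mem (isOpen_Ioo.mem_nhds hx) hd
  have hcomp : ∀ {g : ℝ → ℝ → ℝ}, AnalyticPlane g U → HasDerivAt (fun t => g t (y t))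
      (edx g x (y x) + edy g x (y x) * deriv y x) x := fun hg => by
    simpa using hg.hasDerivAt_comp (u := fun s => s) (hy x hx) (hasDerivAt_id x) (h1 x hx)
  rw [Filter.EventuallyEq.deriv_eq hev,
    ((hcomp (hη.partial_fst hU)).fun_add ((hcomp (hη.partial_snd hU)).fun_mul h2)).deriv,
    ← hη.edx_edy_comm hU (hy x hx)]
  ring

/-- The coefficients of `y'' = f(x, y, y')` when it is transformed into `ȳ'' = 0` by `η`
satisfy the compatibility conditions. -/
theorem AnalyticPlane.coefficient_conditions {η A B D : ℝ → ℝ → ℝ} {U : Set (ℝ × ℝ)}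
    (hU : IsOpen U) (hη : AnalyticPlane η U) (hne : ∀ x y, (x, y) ∈ U → edy η x y ≠ 0)
    (hA : A = fun x y => -edx (edx η) x y / edy η x y)
    (hB : B = fun x y => -(2 * edx (edy η) x y) / edy η x y)
    (hD : D = fun x y => -edy (edy η) x y / edy η x y) {x y : ℝ} (h : (x, y) ∈ U) :
    edy B x y = 2 * edx D x y ∧
      edx B x y = 2 * edy A x y - 2 * D x y * A x y + B x y ^ 2 / 2 := by
  have hx := hη.partial_fst hU
  have hy := hη.partial_snd hU
  have hxx := hx.partial_fst hU
  have hxy := hy.partial_fst hU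
  have hyy := hy.partial_snd hU
  have hu := hne x y h
  have hBy : edy B x y = (-(2 * edy (edx (edy η)) x y) * edy η x y
      - -(2 * edx (edy η) x y) * edy (edy η) x y) / edy η x y ^ 2 := by
    rw [hB]
    exact ((((hxy.hasDerivAt_edy h).const_mul 2).fun_neg).fun_div (hy.hasDerivAt_edy h) hu).deriv
  have hBx : edx B x y = (-(2 * edx (edx (edy η)) x y) * edy η x y
      - -(2 * edx (edy η) x y) * edx (edy η) x y) / edy η x y ^ 2 := by
    rw [hB]
    exact ((((hxy.hasDerivAt_edx h).const_mul 2).fun_neg).fun_div (hy.hasDerivAt_edx h) hu).deriv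
  have hDx : edx D x y = (-edx (edy (edy η)) x y * edy η x y
      - -edy (edy η) x y * edx (edy η) x y) / edy η x y ^ 2 := by
    rw [hD]
    exact ((hyy.hasDerivAt_edx h).fun_neg.fun_div (hy.hasDerivAt_edx h) hu).deriv
  have hAy : edy A x y = (-edy (edx (edx η)) x y * edy η x y
      - -edx (edx η) x y * edy (edy η) x y) / edy η x y ^ 2 := by
    rw [hA]
    exact ((hxx.hasDerivAt_edy h).fun_neg.fun_div (hy.hasDerivAt_edy h) hu).deriv
  have c1 : edx (edy (edy η)) x y = edy (edx (edy η)) x y := hy.edx_edy_comm hU h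
  have c2 : edy (edx (edx η)) x y = edx (edx (edy η)) x y := by
    rw [← hx.edx_edy_comm hU h]
    exact edx_congr hU h fun a b hab => (hη.edx_edy_comm hU hab).symm
  rw [hBy, hBx, hDx, hAy, c1, c2]
  simp only [hA, hB, hD]
  constructor
  · field_simp
  · field_simp
    ring

/-- The compatibility conditions on the coefficients are sufficient for the existence, on a convex
open set, of a linearizing `η`. -/
theorem AnalyticPlane.exists_linearization {A B D : ℝ → ℝ → ℝ} {U : Set (ℝ × ℝ)}
    (hU : IsOpen U) (hc : Convex ℝ U)
    (hA : AnalyticPlane A U) (hB : AnalyticPlane B U) (hD : AnalyticPlane D U)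
    (h : ∀ x y, (x, y) ∈ U → edy B x y = 2 * edx D x y ∧
      edx B x y = 2 * edy A x y - 2 * D x y * A x y + B x y ^ 2 / 2) :
    ∃ η : ℝ → ℝ → ℝ, AnalyticPlane η U ∧ ∀ x y, (x, y) ∈ U → edy η x y ≠ 0 ∧
      edx (edx η) x y = -A x y * edy η x y ∧
      2 * edx (edy η) x y = -B x y * edy η x y ∧
      edy (edy η) x y = -D x y * edy η x y := by
  obtain ⟨v, hv, hvd⟩ := exists_primitive (P := fun x y => -B x y / 2) (Q := fun x y => -D x y)
    hU hc (fun w hw => (hB w hw).neg.div analyticAt_const two_ne_zero) (fun w hw => (hD w hw).neg)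
    fun x y hxy => by
      have e1 : edy (fun x y => -B x y / 2) x y = -edy B x y / 2 :=
        ((hB.hasDerivAt_edy hxy).fun_neg.div_const 2).deriv
      have e2 : edx (fun x y => -D x y) x y = -edx D x y := (hD.hasDerivAt_edx hxy).fun_neg.deriv
      rw [e1, e2, (h x y hxy).1]
      ring
  have hux : ∀ x y, (x, y) ∈ U → HasDerivAt (fun t => Real.exp (v t y))
      (Real.exp (v x y) * (-B x y / 2)) x := fun x y hxy =>
    (hvd x y hxy).1 ▸ (hv.hasDerivAt_edx hxy).exp
  have huy : ∀ x y, (x, y) ∈ U → HasDerivAt (fun t => Real.exp (v x t))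
      (Real.exp (v x y) * -D x y) y := fun x y hxy =>
    (hvd x y hxy).2 ▸ (hv.hasDerivAt_edy hxy).exp
  have hu : AnalyticPlane (fun x y => Real.exp (v x y)) U := fun w hw => (hv w hw).rexp
  obtain ⟨w, hw, hwd⟩ := exists_primitive (P := fun x y => -A x y * Real.exp (v x y))
    (Q := fun x y => -B x y / 2 * Real.exp (v x y)) hU hc (fun w hw => (hA w hw).neg.mul (hu w hw))
    (fun w hw => ((hB w hw).neg.div analyticAt_const two_ne_zero).mul (hu w hw))
    fun x y hxy => by
      have e1 : edy (fun x y => -A x y * Real.exp (v x y)) x y = _ :=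
        ((hA.hasDerivAt_edy hxy).fun_neg.fun_mul (huy x y hxy)).deriv
      have e2 : edx (fun x y => -B x y / 2 * Real.exp (v x y)) x y = _ :=
        (((hB.hasDerivAt_edx hxy).fun_neg.div_const 2).fun_mul (hux x y hxy)).deriv
      rw [e1, e2, (h x y hxy).2]
      ring
  obtain ⟨η, hη, hηd⟩ := exists_primitive hU hc hw hu fun x y hxy => by
    have e2 : edx (fun x y => Real.exp (v x y)) x y = _ := (hux x y hxy).deriv
    rw [(hwd x y hxy).2, e2, mul_comm]
  refine ⟨η, hη, fun x y hxy => ?_⟩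
  have e1 : edx (edx η) x y = edx w x y := edx_congr hU hxy fun a b hab => (hηd a b hab).1
  have e2 : edx (edy η) x y = edx (fun x y => Real.exp (v x y)) x y :=
    edx_congr hU hxy fun a b hab => (hηd a b hab).2
  have e3 : edy (edy η) x y = edy (fun x y => Real.exp (v x y)) x y :=
    edy_congr hU hxy fun a b hab => (hηd a b hab).2
  have e4 : edx (fun x y => Real.exp (v x y)) x y = _ := (hux x y hxy).deriv
  have e5 : edy (fun x y => Real.exp (v x y)) x y = _ := (huy x y hxy).deriv
  rw [e1, e2, e3, e4, e5, (hwd x y hxy).1, (hηd x y hxy).2]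
  exact ⟨(Real.exp_pos _).ne', rfl, by ring, by ring⟩

end Auxiliary

/-- For real-analytic `f` on `Ω × ℝ`, the equation `y'' = f(x, y, y')` is
locally equivalent to `ȳ'' = 0` under the pseudogroup `(x, y) ↦ (x + C, η(x, y))`
(in the sense that every solution is mapped to a curve with vanishing second
derivative, condition (a)) iff `f_ppp = 0` and
`f_xp = -f_pp·f + 2·f_y + (1/2)·f_p² - p·f_yp` on `Ω × ℝ` (condition (b)). -/
theorem statement3
    (Ω : Set (ℝ × ℝ)) (hΩo : IsOpen Ω) (hΩc : IsConnected Ω)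
    (f : ℝ → ℝ → ℝ → ℝ)
    (hf : AnalyticOnNhd ℝ (fun z : ℝ × ℝ × ℝ => f z.1 z.2.1 z.2.2)
      {z : ℝ × ℝ × ℝ | (z.1, z.2.1) ∈ Ω}) :
    (∀ P ∈ Ω, ∃ Ω' : Set (ℝ × ℝ),
        Ω' ⊆ Ω ∧ IsOpen Ω' ∧ IsConnected Ω' ∧ P ∈ Ω' ∧
        ∃ C : ℝ, ∃ η : ℝ → ℝ → ℝ,
          AnalyticOnNhd ℝ (fun w : ℝ × ℝ => η w.1 w.2) Ω' ∧
          (∀ w ∈ Ω', edy η w.1 w.2 ≠ 0) ∧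
          (∀ a b : ℝ, ∀ y : ℝ → ℝ,
            (∀ x ∈ Set.Ioo a b, (x, y x) ∈ Ω') →
            ContDiffOn ℝ 2 y (Set.Ioo a b) →
            (∀ x ∈ Set.Ioo a b, deriv (deriv y) x = f x (y x) (deriv y x)) →
            -- the transformed curve `x̄ = x + C ↦ ȳ = η(x, y(x))` satisfies `d²ȳ/dx̄² = 0`,
            -- i.e. `x ↦ η(x, y(x))` has vanishing second derivative (is affine)
            ∀ x ∈ Set.Ioo a b, deriv (deriv (fun t => η t (y t))) x = 0))
    ↔
    (∀ w ∈ Ω, ∀ p : ℝ,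
      pdp (pdp (pdp f)) w.1 w.2 p = 0 ∧
      pdp (pdx f) w.1 w.2 p =
        - pdp (pdp f) w.1 w.2 p * f w.1 w.2 p + 2 * pdy f w.1 w.2 p
          + (1 / 2) * (pdp f w.1 w.2 p) ^ 2 - p * pdp (pdy f) w.1 w.2 p) := by
  have hS : IsOpen {z : ℝ × ℝ × ℝ | (z.1, z.2.1) ∈ Ω} := hΩo.preimage (by fun_prop)
  constructor
  · intro H w hw
    obtain ⟨U, hUΩ, hU, -, hwU, -, η, hη, hne, hsol⟩ := H w hw
    have hη : AnalyticPlane η U := hη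
    have hy := hη.partial_snd hU
    have hne' : ∀ x y, (x, y) ∈ U → edy η x y ≠ 0 := fun x y hxy => hne (x, y) hxy
    refine (pdp_conditions_iff_of_quadratic hU
      (A := fun x y => -edx (edx η) x y / edy η x y)
      (B := fun x y => -(2 * edx (edy η) x y) / edy η x y)
      (D := fun x y => -edy (edy η) x y / edy η x y)
      (fun z hz => ((hη.partial_fst hU).partial_fst hU z hz).neg.div (hy z hz) (hne z hz))
      (fun z hz => (analyticAt_const.mul (hy.partial_fst hU z hz)).neg.div (hy z hz) (hne z hz))
      (fun z hz => (hy.partial_snd hU z hz).neg.div (hy z hz) (hne z hz)) ?_ hwU).2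
      (hη.coefficient_conditions hU hne' rfl rfl rfl hwU)
    intro x₀ y₀ h₀ p₀
    obtain ⟨ε, hε, y, hy₀, hp₀, hyU, hyc, hode⟩ :=
      exists_solution_of_analytic hU (hf.mono fun z hz => hUΩ hz) h₀ p₀
    have hx₀ : x₀ ∈ Set.Ioo (x₀ - ε) (x₀ + ε) := by constructor <;> linarith
    have h2 := hsol _ _ y hyU hyc hode x₀ hx₀
    rw [hη.deriv_deriv_comp hU hyU hyc hx₀, hode x₀ hx₀, hy₀, hp₀] at h2
    have := hne' x₀ y₀ h₀
    field_simp
    linear_combination h2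
  · intro H P hP
    obtain ⟨r, hr, hrΩ⟩ := Metric.isOpen_iff.1 hΩo P hP
    have hU : IsOpen (Metric.ball P r) := Metric.isOpen_ball
    have hfp := hf.pdp hS
    have hfpp := hfp.pdp hS
    have hslice : ∀ {g : ℝ → ℝ → ℝ → ℝ},
        AnalyticOnNhd ℝ (fun z : ℝ × ℝ × ℝ => g z.1 z.2.1 z.2.2)
          {z : ℝ × ℝ × ℝ | (z.1, z.2.1) ∈ Ω} →
        AnalyticPlane (fun x y => g x y 0) (Metric.ball P r) := fun {g} hg w hw =>
      AnalyticAt.fun_comp (g := fun z : ℝ × ℝ × ℝ => g z.1 z.2.1 z.2.2)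
        (f := fun w : ℝ × ℝ => (w.1, w.2, (0 : ℝ))) (hg (w.1, w.2, 0) (hrΩ hw))
        (analyticAt_fst.prod (analyticAt_snd.prod analyticAt_const))
    have hdiff : ∀ {g : ℝ → ℝ → ℝ → ℝ},
        AnalyticOnNhd ℝ (fun z : ℝ × ℝ × ℝ => g z.1 z.2.1 z.2.2)
          {z : ℝ × ℝ × ℝ | (z.1, z.2.1) ∈ Ω} →
        ∀ x y, (x, y) ∈ Ω → Differentiable ℝ (g x y) := fun {g} hg x y hxy p =>
      DifferentiableAt.fun_comp' p (g := fun z : ℝ × ℝ × ℝ => g z.1 z.2.1 z.2.2)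
        (f := fun t : ℝ => (x, y, t)) (hg (x, y, p) hxy).differentiableAt (by fun_prop)
    have hA := hslice hf
    have hB := hslice hfp
    have hD : AnalyticPlane (fun x y => pdp (pdp f) x y 0 / 2) (Metric.ball P r) := fun w hw =>
      (hslice hfpp w hw).div analyticAt_const two_ne_zero
    have hquad : ∀ x y, (x, y) ∈ Metric.ball P r → ∀ p,
        f x y p = f x y 0 + pdp f x y 0 * p + pdp (pdp f) x y 0 / 2 * p ^ 2 := fun x y hxy p =>
      eq_quadratic_of_deriv_deriv_deriv_eq_zero_s3 (hdiff hf x y (hrΩ hxy)) (hdiff hfp x y (hrΩ hxy))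
        (hdiff hfpp x y (hrΩ hxy)) (fun p => (H (x, y) (hrΩ hxy) p).1) p
    obtain ⟨η, hη, hηd⟩ := AnalyticPlane.exists_linearization hU (convex_ball P r) hA hB hD
      fun x y hxy => (pdp_conditions_iff_of_quadratic hU hA hB hD hquad hxy).1
        (H (x, y) (hrΩ hxy))
    refine ⟨Metric.ball P r, hrΩ, hU, (convex_ball P r).isConnected ⟨P, Metric.mem_ball_self hr⟩,
      Metric.mem_ball_self hr, 0, η, hη, fun w hw => (hηd w.1 w.2 hw).1, ?_⟩
    intro a b y hyU hyc hode x hx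
    obtain ⟨-, h1, h2, h3⟩ := hηd x (y x) (hyU x hx)
    rw [hη.deriv_deriv_comp hU hyU hyc hx, hode x hx, hquad x (y x) (hyU x hx) (deriv y x)]
    linear_combination h1 + deriv y x * h2 + deriv y x ^ 2 * h3
end

section
/- Let U ⊆ ℝ³ be open with coordinates (x, y, p), let f : U → ℝ be smooth, and let M = {(x, y, p, a₃) : (x, y, p) ∈ U, a₃ ≠ 0} ⊆ ℝ⁴. Define on M the functions I₁ = −(1/4)·f_p² − f_y + (1/2)·D_x f_p, I₂ = f_{ppp}/(2a₃²), I₃ = (f_{yp} − D_x f_{pp})/(2a₃), and the vector fields X₁ = (1/a₃)·∂/∂p, X₂ = (1/a₃)·∂/∂y + (f_p/(2a₃))·∂/∂p − (1/2)·f_{pp}·∂/∂a₃, X₃ = ∂/∂x + p·∂/∂y + f·∂/∂p − (1/2)·f_p·a₃·∂/∂a₃, X₄ = a₃·∂/∂a₃. Then the following five syzygies hold identically on M: X₁I₁ = −I₃, X₄I₁ = 0, X₄I₂ = −2I₂, X₁I₃ = −X₃I₂, X₄I₃ = −I₃. -/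
/-- Total derivative `D_x = ∂/∂x + p·∂/∂y + f·∂/∂p` along `y'' = f(x, y, y')`. -/
noncomputable def DxOp (f g : ℝ → ℝ → ℝ → ℝ) : ℝ → ℝ → ℝ → ℝ :=
  fun x y p => pdx g x y p + p * pdy g x y p + f x y p * pdp g x y p

/-- Fundamental invariant `I₁ = -(1/4)·f_p² - f_y + (1/2)·D_x f_p`
(a function on `M ⊆ ℝ⁴` with coordinates `(x, y, p, a₃)`). -/
noncomputable def Inv1 (f : ℝ → ℝ → ℝ → ℝ) (z : ℝ × ℝ × ℝ × ℝ) : ℝ :=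
  -(1 / 4) * (pdp f z.1 z.2.1 z.2.2.1) ^ 2 - pdy f z.1 z.2.1 z.2.2.1
    + (1 / 2) * DxOp f (pdp f) z.1 z.2.1 z.2.2.1

/-- Fundamental invariant `I₂ = f_ppp / (2·a₃²)`. -/
noncomputable def Inv2 (f : ℝ → ℝ → ℝ → ℝ) (z : ℝ × ℝ × ℝ × ℝ) : ℝ :=
  pdp (pdp (pdp f)) z.1 z.2.1 z.2.2.1 / (2 * z.2.2.2 ^ 2)

/-- Fundamental invariant `I₃ = (f_yp - D_x f_pp) / (2·a₃)`. -/
noncomputable def Inv3 (f : ℝ → ℝ → ℝ → ℝ) (z : ℝ × ℝ × ℝ × ℝ) : ℝ :=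
  (pdp (pdy f) z.1 z.2.1 z.2.2.1 - DxOp f (pdp (pdp f)) z.1 z.2.1 z.2.2.1) / (2 * z.2.2.2)

/-- Invariant derivation `X₁ = (1/a₃)·∂/∂p`, as a vector field on `ℝ⁴ = (x, y, p, a₃)`. -/
noncomputable def Xf1 (f : ℝ → ℝ → ℝ → ℝ) (z : ℝ × ℝ × ℝ × ℝ) : ℝ × ℝ × ℝ × ℝ :=
  (0, 0, 1 / z.2.2.2, 0)

/-- Invariant derivation `X₂ = (1/a₃)·∂/∂y + (f_p/(2a₃))·∂/∂p - (1/2)·f_pp·∂/∂a₃`. -/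
noncomputable def Xf2 (f : ℝ → ℝ → ℝ → ℝ) (z : ℝ × ℝ × ℝ × ℝ) : ℝ × ℝ × ℝ × ℝ :=
  (0, 1 / z.2.2.2, pdp f z.1 z.2.1 z.2.2.1 / (2 * z.2.2.2),
    -(1 / 2) * pdp (pdp f) z.1 z.2.1 z.2.2.1)

/-- Invariant derivation `X₃ = ∂/∂x + p·∂/∂y + f·∂/∂p - (1/2)·f_p·a₃·∂/∂a₃`. -/
noncomputable def Xf3 (f : ℝ → ℝ → ℝ → ℝ) (z : ℝ × ℝ × ℝ × ℝ) : ℝ × ℝ × ℝ × ℝ :=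
  (1, z.2.2.1, f z.1 z.2.1 z.2.2.1, -(1 / 2) * pdp f z.1 z.2.1 z.2.2.1 * z.2.2.2)

/-- Invariant derivation `X₄ = a₃·∂/∂a₃`. -/
noncomputable def Xf4 (f : ℝ → ℝ → ℝ → ℝ) (z : ℝ × ℝ × ℝ × ℝ) : ℝ × ℝ × ℝ × ℝ :=
  (0, 0, 0, z.2.2.2)

open scoped ContDiff

/-- Smoothness on `U` of a function of `(x, y, p)`. -/
def SmoothIn (U : Set (ℝ × ℝ × ℝ)) (g : ℝ → ℝ → ℝ → ℝ) : Prop :=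
  ContDiffOn ℝ ∞ (fun w : ℝ × ℝ × ℝ => g w.1 w.2.1 w.2.2) U

namespace SmoothIn

variable {U : Set (ℝ × ℝ × ℝ)} {f g : ℝ → ℝ → ℝ → ℝ} {x y p : ℝ}

theorem differentiableAt (hg : SmoothIn U g) (hU : IsOpen U) {w : ℝ × ℝ × ℝ} (hw : w ∈ U) :
    DifferentiableAt ℝ (fun w : ℝ × ℝ × ℝ => g w.1 w.2.1 w.2.2) w :=
  (hg.contDiffAt (hU.mem_nhds hw)).differentiableAt (by simp)

theorem hasDerivAt_fst (hg : SmoothIn U g) (hU : IsOpen U) (hw : (x, y, p) ∈ U) :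
    HasDerivAt (fun t => g t y p)
      (fderiv ℝ (fun w : ℝ × ℝ × ℝ => g w.1 w.2.1 w.2.2) (x, y, p) (1, 0, 0)) x :=
  (hg.differentiableAt hU hw).hasFDerivAt.comp_hasDerivAt x
    (f := fun t => ((t, y, p) : ℝ × ℝ × ℝ))
    ((hasDerivAt_id x).prodMk (hasDerivAt_const x (y, p)))

theorem hasDerivAt_snd (hg : SmoothIn U g) (hU : IsOpen U) (hw : (x, y, p) ∈ U) :
    HasDerivAt (fun t => g x t p)
      (fderiv ℝ (fun w : ℝ × ℝ × ℝ => g w.1 w.2.1 w.2.2) (x, y, p) (0, 1, 0)) y :=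
  (hg.differentiableAt hU hw).hasFDerivAt.comp_hasDerivAt y
    (f := fun t => ((x, t, p) : ℝ × ℝ × ℝ))
    ((hasDerivAt_const y x).prodMk ((hasDerivAt_id y).prodMk (hasDerivAt_const y p)))

theorem hasDerivAt_trd (hg : SmoothIn U g) (hU : IsOpen U) (hw : (x, y, p) ∈ U) :
    HasDerivAt (fun t => g x y t)
      (fderiv ℝ (fun w : ℝ × ℝ × ℝ => g w.1 w.2.1 w.2.2) (x, y, p) (0, 0, 1)) p :=
  (hg.differentiableAt hU hw).hasFDerivAt.comp_hasDerivAt p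
    (f := fun t => ((x, y, t) : ℝ × ℝ × ℝ))
    ((hasDerivAt_const p x).prodMk ((hasDerivAt_const p y).prodMk (hasDerivAt_id p)))

theorem pdx_eq (hg : SmoothIn U g) (hU : IsOpen U) (hw : (x, y, p) ∈ U) :
    pdx g x y p = fderiv ℝ (fun w : ℝ × ℝ × ℝ => g w.1 w.2.1 w.2.2) (x, y, p) (1, 0, 0) :=
  (hg.hasDerivAt_fst hU hw).deriv

theorem pdy_eq (hg : SmoothIn U g) (hU : IsOpen U) (hw : (x, y, p) ∈ U) :
    pdy g x y p = fderiv ℝ (fun w : ℝ × ℝ × ℝ => g w.1 w.2.1 w.2.2) (x, y, p) (0, 1, 0) :=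
  (hg.hasDerivAt_snd hU hw).deriv

theorem pdp_eq (hg : SmoothIn U g) (hU : IsOpen U) (hw : (x, y, p) ∈ U) :
    pdp g x y p = fderiv ℝ (fun w : ℝ × ℝ × ℝ => g w.1 w.2.1 w.2.2) (x, y, p) (0, 0, 1) :=
  (hg.hasDerivAt_trd hU hw).deriv

theorem hasDerivAt_pdp (hg : SmoothIn U g) (hU : IsOpen U) (hw : (x, y, p) ∈ U) :
    HasDerivAt (fun t => g x y t) (pdp g x y p) p :=
  hg.pdp_eq hU hw ▸ hg.hasDerivAt_trd hU hw

theorem contDiffOn_fderiv_apply (hg : SmoothIn U g) (hU : IsOpen U) (v : ℝ × ℝ × ℝ) :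
    ContDiffOn ℝ ∞
      (fun w => fderiv ℝ (fun w : ℝ × ℝ × ℝ => g w.1 w.2.1 w.2.2) w v) U :=
  (hg.fderiv_of_isOpen hU (by simp)).clm_apply contDiffOn_const

protected theorem pdx (hg : SmoothIn U g) (hU : IsOpen U) : SmoothIn U (pdx g) :=
  (hg.contDiffOn_fderiv_apply hU (1, 0, 0)).congr fun _ hw => hg.pdx_eq hU hw

protected theorem pdy (hg : SmoothIn U g) (hU : IsOpen U) : SmoothIn U (pdy g) :=
  (hg.contDiffOn_fderiv_apply hU (0, 1, 0)).congr fun _ hw => hg.pdy_eq hU hw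

protected theorem pdp (hg : SmoothIn U g) (hU : IsOpen U) : SmoothIn U (pdp g) :=
  (hg.contDiffOn_fderiv_apply hU (0, 0, 1)).congr fun _ hw => hg.pdp_eq hU hw

protected theorem DxOp (hf : SmoothIn U f) (hg : SmoothIn U g) (hU : IsOpen U) :
    SmoothIn U (DxOp f g) := by
  have hp : ContDiffOn ℝ ∞ (fun w : ℝ × ℝ × ℝ => w.2.2) U := by fun_prop
  exact (ContDiffOn.add (hg.pdx hU) (ContDiffOn.mul hp (hg.pdy hU))).add
    (ContDiffOn.mul hf (hg.pdp hU))

/-- Derivatives of directional derivatives are values of the second derivative. -/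
theorem fderiv_apply_eq (hg : SmoothIn U g) (hU : IsOpen U) {w : ℝ × ℝ × ℝ} (hw : w ∈ U)
    {k : ℝ × ℝ × ℝ → ℝ} {v : ℝ × ℝ × ℝ}
    (hk : ∀ w ∈ U, k w = fderiv ℝ (fun w : ℝ × ℝ × ℝ => g w.1 w.2.1 w.2.2) w v)
    (u : ℝ × ℝ × ℝ) :
    fderiv ℝ k w u =
      fderiv ℝ (fderiv ℝ (fun w : ℝ × ℝ × ℝ => g w.1 w.2.1 w.2.2)) w u v := by
  have hd : DifferentiableAt ℝ (fderiv ℝ (fun w : ℝ × ℝ × ℝ => g w.1 w.2.1 w.2.2)) w :=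
    ((hg.fderiv_of_isOpen (m := ∞) hU (by simp)).contDiffAt
      (hU.mem_nhds hw)).differentiableAt (by simp)
  rw [(Filter.eventuallyEq_of_mem (hU.mem_nhds hw) hk).fderiv_eq,
    (hd.hasFDerivAt.clm_apply (hasFDerivAt_const v w)).fderiv]
  simp

theorem isSymmSndFDerivAt (hg : SmoothIn U g) (hU : IsOpen U) {w : ℝ × ℝ × ℝ} (hw : w ∈ U) :
    IsSymmSndFDerivAt ℝ (fun w : ℝ × ℝ × ℝ => g w.1 w.2.1 w.2.2) w :=
  (hg.contDiffAt (hU.mem_nhds hw)).isSymmSndFDerivAt (by simpa using WithTop.coe_le_coe.2 (le_top : (2 : ℕ∞) ≤ ⊤))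

theorem pdp_pdx (hg : SmoothIn U g) (hU : IsOpen U) (hw : (x, y, p) ∈ U) :
    pdp (pdx g) x y p = pdx (pdp g) x y p := by
  rw [(hg.pdx hU).pdp_eq hU hw, (hg.pdp hU).pdx_eq hU hw,
    hg.fderiv_apply_eq hU hw fun _ => hg.pdx_eq hU,
    hg.fderiv_apply_eq hU hw fun _ => hg.pdp_eq hU]
  exact hg.isSymmSndFDerivAt hU hw _ _

theorem pdp_pdy (hg : SmoothIn U g) (hU : IsOpen U) (hw : (x, y, p) ∈ U) :
    pdp (pdy g) x y p = pdy (pdp g) x y p := by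
  rw [(hg.pdy hU).pdp_eq hU hw, (hg.pdp hU).pdy_eq hU hw,
    hg.fderiv_apply_eq hU hw fun _ => hg.pdy_eq hU,
    hg.fderiv_apply_eq hU hw fun _ => hg.pdp_eq hU]
  exact hg.isSymmSndFDerivAt hU hw _ _

/-- The commutator of `∂/∂p` and `D_x` is `∂/∂y + f_p·∂/∂p`. -/
theorem pdp_DxOp (hf : SmoothIn U f) (hg : SmoothIn U g) (hU : IsOpen U)
    (hw : (x, y, p) ∈ U) :
    pdp (DxOp f g) x y p =
      DxOp f (pdp g) x y p + pdy g x y p + pdp f x y p * pdp g x y p := by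
  have key := (((hg.pdx hU).hasDerivAt_pdp hU hw).add
    ((hasDerivAt_id p).mul ((hg.pdy hU).hasDerivAt_pdp hU hw))).add
    ((hf.hasDerivAt_pdp hU hw).mul ((hg.pdp hU).hasDerivAt_pdp hU hw))
  refine HasDerivAt.deriv (key.congr_deriv ?_)
  rw [hg.pdp_pdx hU hw, hg.pdp_pdy hU hw]
  simp only [DxOp, id]
  ring

theorem hasFDerivAt_lift (hg : SmoothIn U g) (hU : IsOpen U) {z : ℝ × ℝ × ℝ × ℝ}
    (hz : (z.1, z.2.1, z.2.2.1) ∈ U) :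
    ∃ L : (ℝ × ℝ × ℝ × ℝ) →L[ℝ] ℝ,
      HasFDerivAt (fun z : ℝ × ℝ × ℝ × ℝ => g z.1 z.2.1 z.2.2.1) L z ∧
      ∀ v, L v = pdx g z.1 z.2.1 z.2.2.1 * v.1 + pdy g z.1 z.2.1 z.2.2.1 * v.2.1
        + pdp g z.1 z.2.1 z.2.2.1 * v.2.2.1 := by
  let P : (ℝ × ℝ × ℝ × ℝ) →L[ℝ] ℝ × ℝ × ℝ :=
    (ContinuousLinearMap.id ℝ ℝ).prodMap
      ((ContinuousLinearMap.id ℝ ℝ).prodMap (ContinuousLinearMap.fst ℝ ℝ ℝ))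
  refine ⟨_, HasFDerivAt.comp z (g := fun w : ℝ × ℝ × ℝ => g w.1 w.2.1 w.2.2)
    (hg.differentiableAt hU (w := P z) hz).hasFDerivAt P.hasFDerivAt, fun v => ?_⟩
  rw [hg.pdx_eq hU hz, hg.pdy_eq hU hz, hg.pdp_eq hU hz]
  have hv : P v = v.1 • ((1, 0, 0) : ℝ × ℝ × ℝ) + v.2.1 • ((0, 1, 0) : ℝ × ℝ × ℝ)
      + v.2.2.1 • ((0, 0, 1) : ℝ × ℝ × ℝ) := by
    simp [P]
    rfl
  rw [ContinuousLinearMap.comp_apply, hv]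
  simp only [map_add, map_smul, smul_eq_mul]
  change v.1 * fderiv ℝ _ (z.1, z.2.1, z.2.2.1) _ + v.2.1 * fderiv ℝ _ (z.1, z.2.1, z.2.2.1) _
    + v.2.2.1 * fderiv ℝ _ (z.1, z.2.1, z.2.2.1) _ = _
  ring

theorem fderiv_lift (hg : SmoothIn U g) (hU : IsOpen U) {z : ℝ × ℝ × ℝ × ℝ}
    (hz : (z.1, z.2.1, z.2.2.1) ∈ U) (v : ℝ × ℝ × ℝ × ℝ) :
    fderiv ℝ (fun z : ℝ × ℝ × ℝ × ℝ => g z.1 z.2.1 z.2.2.1) z v =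
      pdx g z.1 z.2.1 z.2.2.1 * v.1 + pdy g z.1 z.2.1 z.2.2.1 * v.2.1
        + pdp g z.1 z.2.1 z.2.2.1 * v.2.2.1 := by
  obtain ⟨L, hL, hLv⟩ := hg.hasFDerivAt_lift hU hz
  rw [hL.fderiv, hLv]

theorem fderiv_lift_div (hg : SmoothIn U g) (hU : IsOpen U) {z : ℝ × ℝ × ℝ × ℝ}
    (hz : (z.1, z.2.1, z.2.2.1) ∈ U) (ha : z.2.2.2 ≠ 0) (n : ℕ) (v : ℝ × ℝ × ℝ × ℝ) :
    fderiv ℝ (fun z : ℝ × ℝ × ℝ × ℝ => g z.1 z.2.1 z.2.2.1 / (2 * z.2.2.2 ^ n)) z v =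
      (pdx g z.1 z.2.1 z.2.2.1 * v.1 + pdy g z.1 z.2.1 z.2.2.1 * v.2.1
        + pdp g z.1 z.2.1 z.2.2.1 * v.2.2.1) / (2 * z.2.2.2 ^ n)
      - n * g z.1 z.2.1 z.2.2.1 * v.2.2.2 / (2 * z.2.2.2 ^ (n + 1)) := by
  obtain ⟨L, hL, hLv⟩ := hg.hasFDerivAt_lift hU hz
  have hA : HasFDerivAt (fun z : ℝ × ℝ × ℝ × ℝ => z.2.2.2) _ z :=
    (hasFDerivAt_id (𝕜 := ℝ) z).snd.snd.snd
  have h2 : (2 * z.2.2.2 ^ n : ℝ) ≠ 0 := by positivity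
  have hD := (((hasDerivAt_pow n z.2.2.2).const_mul 2).fun_inv h2).comp_hasFDerivAt z hA
  have hI : HasFDerivAt
      (fun z : ℝ × ℝ × ℝ × ℝ => g z.1 z.2.1 z.2.2.1 / (2 * z.2.2.2 ^ n)) _ z :=
    hL.mul hD
  rw [hI.fderiv]
  rcases n with _ | n
  · simp [hLv]
    ring
  · simp [hLv]
    field_simp
    ring

end SmoothIn

/-- The function of `(x, y, p)` underlying `Inv1`. -/
noncomputable def baseInv1 (f : ℝ → ℝ → ℝ → ℝ) : ℝ → ℝ → ℝ → ℝ :=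
  fun x y p => -(1 / 4) * (pdp f x y p) ^ 2 - pdy f x y p + (1 / 2) * DxOp f (pdp f) x y p

/-- The numerator of `Inv3`. -/
noncomputable def numInv3 (f : ℝ → ℝ → ℝ → ℝ) : ℝ → ℝ → ℝ → ℝ :=
  fun x y p => pdp (pdy f) x y p - DxOp f (pdp (pdp f)) x y p

namespace SmoothIn

variable {U : Set (ℝ × ℝ × ℝ)} {f : ℝ → ℝ → ℝ → ℝ} {x y p : ℝ}

protected theorem baseInv1 (hf : SmoothIn U f) (hU : IsOpen U) : SmoothIn U (baseInv1 f) :=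
  ((contDiffOn_const.mul (ContDiffOn.pow (hf.pdp hU) 2)).sub (hf.pdy hU)).add
    (contDiffOn_const.mul (hf.DxOp (hf.pdp hU) hU))

protected theorem numInv3 (hf : SmoothIn U f) (hU : IsOpen U) : SmoothIn U (numInv3 f) :=
  ContDiffOn.sub ((hf.pdy hU).pdp hU) (hf.DxOp ((hf.pdp hU).pdp hU) hU)

theorem pdp_baseInv1 (hf : SmoothIn U f) (hU : IsOpen U) (hw : (x, y, p) ∈ U) :
    pdp (baseInv1 f) x y p = -(1 / 2) * numInv3 f x y p := by
  have hfp := hf.pdp hU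
  have key := ((((hfp.hasDerivAt_pdp hU hw).pow 2).const_mul (-(1 / 4))).sub
    ((hf.pdy hU).hasDerivAt_pdp hU hw)).add
    (((hf.DxOp hfp hU).hasDerivAt_pdp hU hw).const_mul (1 / 2))
  refine HasDerivAt.deriv (key.congr_deriv ?_)
  rw [hf.pdp_DxOp hfp hU hw, numInv3, hf.pdp_pdy hU hw]
  push_cast
  ring

theorem pdp_numInv3 (hf : SmoothIn U f) (hU : IsOpen U) (hw : (x, y, p) ∈ U) :
    pdp (numInv3 f) x y p =
      -(DxOp f (pdp (pdp (pdp f))) x y p + pdp f x y p * pdp (pdp (pdp f)) x y p) := by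
  have hfpp := (hf.pdp hU).pdp hU
  have hyp : pdp (pdp (pdy f)) x y p = pdy (pdp (pdp f)) x y p := by
    rw [← (hf.pdp hU).pdp_pdy hU hw, ((hf.pdy hU).pdp hU).pdp_eq hU hw,
      ((hf.pdp hU).pdy hU).pdp_eq hU hw]
    congr 1
    exact (Filter.eventuallyEq_of_mem (hU.mem_nhds hw) fun _ hw' =>
      hf.pdp_pdy hU hw').fderiv_eq
  have key := (((hf.pdy hU).pdp hU).hasDerivAt_pdp hU hw).sub
    ((hf.DxOp hfpp hU).hasDerivAt_pdp hU hw)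
  refine HasDerivAt.deriv (key.congr_deriv ?_)
  rw [hf.pdp_DxOp hfpp hU hw, hyp]
  ring

end SmoothIn

/-- The five syzygies `X₁I₁ = -I₃`, `X₄I₁ = 0`, `X₄I₂ = -2I₂`,
`X₁I₃ = -X₃I₂`, `X₄I₃ = -I₃` between the fundamental invariants of the equivalence
problem for `y'' = f(x, y, y')` hold identically on
`M = {(x, y, p, a₃) : (x, y, p) ∈ U, a₃ ≠ 0}`. Here `Xg` at `z` is the directional
derivative `fderiv ℝ g z (X z)`. -/
theorem statement6
    (U : Set (ℝ × ℝ × ℝ)) (hUo : IsOpen U)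
    (f : ℝ → ℝ → ℝ → ℝ)
    (hf : ContDiffOn ℝ (⊤ : ℕ∞) (fun w : ℝ × ℝ × ℝ => f w.1 w.2.1 w.2.2) U) :
    ∀ z ∈ {z : ℝ × ℝ × ℝ × ℝ | (z.1, z.2.1, z.2.2.1) ∈ U ∧ z.2.2.2 ≠ 0},
      fderiv ℝ (Inv1 f) z (Xf1 f z) = - Inv3 f z ∧
      fderiv ℝ (Inv1 f) z (Xf4 f z) = 0 ∧
      fderiv ℝ (Inv2 f) z (Xf4 f z) = -2 * Inv2 f z ∧
      fderiv ℝ (Inv3 f) z (Xf1 f z) = - fderiv ℝ (Inv2 f) z (Xf3 f z) ∧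
      fderiv ℝ (Inv3 f) z (Xf4 f z) = - Inv3 f z := by
  rintro z ⟨hz, ha⟩
  replace hf : SmoothIn U f := hf
  have hppp := ((hf.pdp hUo).pdp hUo).pdp hUo
  have h1 : ∀ v, fderiv ℝ (Inv1 f) z v = _ := (hf.baseInv1 hUo).fderiv_lift hUo hz
  have h2 : ∀ v, fderiv ℝ (Inv2 f) z v = _ := hppp.fderiv_lift_div hUo hz ha 2
  have e3 : Inv3 f = fun z => numInv3 f z.1 z.2.1 z.2.2.1 / (2 * z.2.2.2 ^ 1) := by
    funext z
    rw [pow_one, Inv3, numInv3]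
  have h3 := (hf.numInv3 hUo).fderiv_lift_div hUo hz ha 1
  rw [← e3] at h3
  have e3z := congrFun e3 z
  refine ⟨?_, ?_, ?_, ?_, ?_⟩
  · rw [h1, e3z, hf.pdp_baseInv1 hUo hz]
    simp only [Xf1]
    field_simp
    ring
  · simp [h1, Xf4]
  · rw [h2, Inv2]
    simp only [Xf4]
    field_simp
    push_cast
    ring
  · rw [h2, h3, hf.pdp_numInv3 hUo hz]
    simp only [Xf1, Xf3, DxOp]
    field_simp
    push_cast
    ring
  · rw [h3, e3z]
    simp only [Xf4]
    field_simp
    push_cast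
    ring
end

section
/- Let U ⊆ ℝ³ be open with coordinates (x, y, p), let f : U → ℝ be smooth, and let M = {(x, y, p, a₃) : (x, y, p) ∈ U, a₃ ≠ 0} ⊆ ℝ⁴. With I₁ = −(1/4)·f_p² − f_y + (1/2)·D_x f_p, I₂ = f_{ppp}/(2a₃²), I₃ = (f_{yp} − D_x f_{pp})/(2a₃), and the vector fields X₁ = (1/a₃)·∂/∂p, X₂ = (1/a₃)·∂/∂y + (f_p/(2a₃))·∂/∂p − (1/2)·f_{pp}·∂/∂a₃, X₃ = ∂/∂x + p·∂/∂y + f·∂/∂p − (1/2)·f_p·a₃·∂/∂a₃, X₄ = a₃·∂/∂a₃, the Lie brackets of the invariant frame satisfy identically on M: [X₁, X₂] = −I₂·X₄, [X₁, X₃] = X₂, [X₁, X₄] = X₁, [X₂, X₃] = −I₁·X₁ − I₃·X₄, [X₂, X₄] = X₂, [X₃, X₄] = 0. -/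
/-- Lie bracket of two vector fields on `ℝ⁴`:
`[V, W](z) = DW(z)·V(z) - DV(z)·W(z)`. -/
noncomputable def vfBracket (V W : ℝ × ℝ × ℝ × ℝ → ℝ × ℝ × ℝ × ℝ)
    (z : ℝ × ℝ × ℝ × ℝ) : ℝ × ℝ × ℝ × ℝ :=
  fderiv ℝ W z (V z) - fderiv ℝ V z (W z)

open scoped ContDiff

/-- The partial derivatives of `g` are the values of its Fréchet derivative on the basis vectors. -/
theorem pd_eq_fderiv {g : ℝ → ℝ → ℝ → ℝ} {w : ℝ × ℝ × ℝ}
    (hg : DifferentiableAt ℝ (fun w : ℝ × ℝ × ℝ => g w.1 w.2.1 w.2.2) w) :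
    pdx g w.1 w.2.1 w.2.2 = fderiv ℝ (fun w : ℝ × ℝ × ℝ => g w.1 w.2.1 w.2.2) w (1, 0, 0) ∧
    pdy g w.1 w.2.1 w.2.2 = fderiv ℝ (fun w : ℝ × ℝ × ℝ => g w.1 w.2.1 w.2.2) w (0, 1, 0) ∧
    pdp g w.1 w.2.1 w.2.2 = fderiv ℝ (fun w : ℝ × ℝ × ℝ => g w.1 w.2.1 w.2.2) w (0, 0, 1) := by
  obtain ⟨x, y, p⟩ := w
  have hx : HasDerivAt (fun t : ℝ => (t, y, p)) ((1 : ℝ), (0 : ℝ), (0 : ℝ)) x :=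
    (hasDerivAt_id x).prodMk (hasDerivAt_const x (y, p))
  have hy : HasDerivAt (fun t : ℝ => (x, t, p)) ((0 : ℝ), (1 : ℝ), (0 : ℝ)) y :=
    (hasDerivAt_const y x).prodMk ((hasDerivAt_id y).prodMk (hasDerivAt_const y p))
  have hp : HasDerivAt (fun t : ℝ => (x, y, t)) ((0 : ℝ), (0 : ℝ), (1 : ℝ)) p :=
    (hasDerivAt_const p x).prodMk ((hasDerivAt_const p y).prodMk (hasDerivAt_id p))
  have hd := hg.hasFDerivAt
  have hdx := HasFDerivAt.comp_hasDerivAt x hd hx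
  have hdy := HasFDerivAt.comp_hasDerivAt y hd hy
  have hdp := HasFDerivAt.comp_hasDerivAt p hd hp
  exact ⟨hdx.deriv, hdy.deriv, hdp.deriv⟩

section OpenSet

variable {U : Set (ℝ × ℝ × ℝ)} {g : ℝ → ℝ → ℝ → ℝ}

theorem differentiableAt_of_smoothOn (hU : IsOpen U)
    (hg : ContDiffOn ℝ ∞ (fun w : ℝ × ℝ × ℝ => g w.1 w.2.1 w.2.2) U)
    {w : ℝ × ℝ × ℝ} (hw : w ∈ U) :
    DifferentiableAt ℝ (fun w : ℝ × ℝ × ℝ => g w.1 w.2.1 w.2.2) w :=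
  (hg.contDiffAt (hU.mem_nhds hw)).differentiableAt (by simp)

theorem contDiffOn_pdp (hU : IsOpen U)
    (hg : ContDiffOn ℝ ∞ (fun w : ℝ × ℝ × ℝ => g w.1 w.2.1 w.2.2) U) :
    ContDiffOn ℝ ∞ (fun w : ℝ × ℝ × ℝ => pdp g w.1 w.2.1 w.2.2) U :=
  ((hg.fderiv_of_isOpen hU (m := ∞) (by simp)).clm_apply contDiffOn_const).congr fun _ hw =>
    (pd_eq_fderiv (differentiableAt_of_smoothOn hU hg hw)).2.2

theorem contDiffOn_pdy (hU : IsOpen U)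
    (hg : ContDiffOn ℝ ∞ (fun w : ℝ × ℝ × ℝ => g w.1 w.2.1 w.2.2) U) :
    ContDiffOn ℝ ∞ (fun w : ℝ × ℝ × ℝ => pdy g w.1 w.2.1 w.2.2) U :=
  ((hg.fderiv_of_isOpen hU (m := ∞) (by simp)).clm_apply contDiffOn_const).congr fun _ hw =>
    (pd_eq_fderiv (differentiableAt_of_smoothOn hU hg hw)).2.1

/-- Symmetry of the mixed second partial derivatives in `y` and `p`. -/
theorem pdy_pdp_eq_pdp_pdy (hU : IsOpen U)
    (hg : ContDiffOn ℝ ∞ (fun w : ℝ × ℝ × ℝ => g w.1 w.2.1 w.2.2) U)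
    {w : ℝ × ℝ × ℝ} (hw : w ∈ U) :
    pdy (pdp g) w.1 w.2.1 w.2.2 = pdp (pdy g) w.1 w.2.1 w.2.2 := by
  have hnhds := hU.mem_nhds hw
  have hd : DifferentiableAt ℝ (fderiv ℝ (fun w : ℝ × ℝ × ℝ => g w.1 w.2.1 w.2.2)) w :=
    ((hg.fderiv_of_isOpen hU (m := ∞) (by simp)).contDiffAt hnhds).differentiableAt (by simp)
  have hp : (fun w : ℝ × ℝ × ℝ => pdp g w.1 w.2.1 w.2.2) =ᶠ[nhds w]
      fun w => fderiv ℝ (fun w : ℝ × ℝ × ℝ => g w.1 w.2.1 w.2.2) w (0, 0, 1) := by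
    filter_upwards [hnhds] with v hv
    exact (pd_eq_fderiv (differentiableAt_of_smoothOn hU hg hv)).2.2
  have hy : (fun w : ℝ × ℝ × ℝ => pdy g w.1 w.2.1 w.2.2) =ᶠ[nhds w]
      fun w => fderiv ℝ (fun w : ℝ × ℝ × ℝ => g w.1 w.2.1 w.2.2) w (0, 1, 0) := by
    filter_upwards [hnhds] with v hv
    exact (pd_eq_fderiv (differentiableAt_of_smoothOn hU hg hv)).2.1
  rw [(pd_eq_fderiv (differentiableAt_of_smoothOn hU (contDiffOn_pdp hU hg) hw)).2.1,
    (pd_eq_fderiv (differentiableAt_of_smoothOn hU (contDiffOn_pdy hU hg) hw)).2.2,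
    hp.fderiv_eq, hy.fderiv_eq, fderiv_clm_apply hd (differentiableAt_const _),
    fderiv_clm_apply hd (differentiableAt_const _)]
  simpa using ((hg.contDiffAt hnhds).isSymmSndFDerivAt
    (by simpa using WithTop.coe_le_coe.2 (le_top : (2 : ℕ∞) ≤ ⊤))).eq (0, 1, 0) (0, 0, 1)

/-- The pullback of `g` to `ℝ⁴` is differentiable, with the directional derivatives given by the
partial derivatives of `g`. -/
theorem hasFDerivAt_pullback (hU : IsOpen U)
    (hg : ContDiffOn ℝ ∞ (fun w : ℝ × ℝ × ℝ => g w.1 w.2.1 w.2.2) U)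
    {z : ℝ × ℝ × ℝ × ℝ} (hz : (z.1, z.2.1, z.2.2.1) ∈ U) :
    ∃ L : ℝ × ℝ × ℝ × ℝ →L[ℝ] ℝ,
      HasFDerivAt (fun z : ℝ × ℝ × ℝ × ℝ => g z.1 z.2.1 z.2.2.1) L z ∧
      ∀ v, L v = v.1 * pdx g z.1 z.2.1 z.2.2.1 + v.2.1 * pdy g z.1 z.2.1 z.2.2.1
        + v.2.2.1 * pdp g z.1 z.2.1 z.2.2.1 := by
  have hd := differentiableAt_of_smoothOn hU hg hz
  let π : ℝ × ℝ × ℝ × ℝ →L[ℝ] ℝ × ℝ × ℝ := (ContinuousLinearMap.fst ℝ ℝ (ℝ × ℝ × ℝ)).prod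
    (((ContinuousLinearMap.fst ℝ ℝ (ℝ × ℝ)).prod
      (ContinuousLinearMap.fst ℝ ℝ ℝ ∘L ContinuousLinearMap.snd ℝ ℝ (ℝ × ℝ))) ∘L
        ContinuousLinearMap.snd ℝ ℝ (ℝ × ℝ × ℝ))
  refine ⟨_, HasFDerivAt.comp z (f := π) hd.hasFDerivAt π.hasFDerivAt, fun v => ?_⟩
  obtain ⟨h1, h2, h3⟩ := pd_eq_fderiv hd
  dsimp only at h1 h2 h3
  rw [h1, h2, h3, ← smul_eq_mul, ← smul_eq_mul, ← smul_eq_mul, ← map_smul, ← map_smul, ← map_smul,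
    ← map_add, ← map_add]
  simp [π]

end OpenSet

/-- The Lie brackets of the invariant frame `X₁, X₂, X₃, X₄` of the
equivalence problem for `y'' = f(x, y, y')` satisfy, identically on
`M = {(x, y, p, a₃) : (x, y, p) ∈ U, a₃ ≠ 0}`:
`[X₁,X₂] = -I₂·X₄`, `[X₁,X₃] = X₂`, `[X₁,X₄] = X₁`,
`[X₂,X₃] = -I₁·X₁ - I₃·X₄`, `[X₂,X₄] = X₂`, `[X₃,X₄] = 0`. -/
theorem statement7
    (U : Set (ℝ × ℝ × ℝ)) (hUo : IsOpen U)
    (f : ℝ → ℝ → ℝ → ℝ)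
    (hf : ContDiffOn ℝ (⊤ : ℕ∞) (fun w : ℝ × ℝ × ℝ => f w.1 w.2.1 w.2.2) U) :
    ∀ z ∈ {z : ℝ × ℝ × ℝ × ℝ | (z.1, z.2.1, z.2.2.1) ∈ U ∧ z.2.2.2 ≠ 0},
      vfBracket (Xf1 f) (Xf2 f) z = (- Inv2 f z) • Xf4 f z ∧
      vfBracket (Xf1 f) (Xf3 f) z = Xf2 f z ∧
      vfBracket (Xf1 f) (Xf4 f) z = Xf1 f z ∧
      vfBracket (Xf2 f) (Xf3 f) z = (- Inv1 f z) • Xf1 f z - Inv3 f z • Xf4 f z ∧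
      vfBracket (Xf2 f) (Xf4 f) z = Xf2 f z ∧
      vfBracket (Xf3 f) (Xf4 f) z = 0 := by
  rintro z ⟨hz, ha⟩
  have hfp := contDiffOn_pdp hUo hf
  obtain ⟨L, hL, hLv⟩ := hasFDerivAt_pullback hUo hf hz
  obtain ⟨Lp, hLp, hLpv⟩ := hasFDerivAt_pullback hUo hfp hz
  obtain ⟨Lpp, hLpp, hLppv⟩ := hasFDerivAt_pullback hUo (contDiffOn_pdp hUo hfp) hz
  have hsymm := pdy_pdp_eq_pdp_pdy hUo hf hz
  have hp : HasFDerivAt (fun z : ℝ × ℝ × ℝ × ℝ => z.2.2.1) _ z :=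
    (ContinuousLinearMap.fst ℝ ℝ ℝ ∘L ContinuousLinearMap.snd ℝ ℝ (ℝ × ℝ) ∘L
      ContinuousLinearMap.snd ℝ ℝ (ℝ × ℝ × ℝ)).hasFDerivAt
  have hA : HasFDerivAt (fun z : ℝ × ℝ × ℝ × ℝ => z.2.2.2) _ z :=
    (ContinuousLinearMap.snd ℝ ℝ ℝ ∘L ContinuousLinearMap.snd ℝ ℝ (ℝ × ℝ) ∘L
      ContinuousLinearMap.snd ℝ ℝ (ℝ × ℝ × ℝ)).hasFDerivAt
  have hinv := (hasDerivAt_inv ha).comp_hasFDerivAt z hA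
  have h0 := hasFDerivAt_const (𝕜 := ℝ) (0 : ℝ) z
  have h1 := h0.prodMk (h0.prodMk (hinv.prodMk h0))
  have h2 := h0.prodMk (hinv.prodMk (((hLp.mul hinv).const_mul (1 / 2)).prodMk
    (hLpp.const_mul (-(1 / 2)))))
  have h3 := (hasFDerivAt_const (𝕜 := ℝ) (1 : ℝ) z).prodMk
    (hp.prodMk (hL.prodMk ((hLp.const_mul (-(1 / 2))).mul hA)))
  have h4 := h0.prodMk (h0.prodMk (h0.prodMk hA))
  have e1 : HasFDerivAt (Xf1 f) _ z := h1.congr_of_eventuallyEq <| .of_forall fun w => by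
    simp [Xf1]
  have e2 : HasFDerivAt (Xf2 f) _ z := h2.congr_of_eventuallyEq <| .of_forall fun w => by
    simp [Xf2]
    ring
  have e3 : HasFDerivAt (Xf3 f) _ z := h3
  have e4 : HasFDerivAt (Xf4 f) _ z := h4
  simp only [vfBracket, e1.fderiv, e2.fderiv, e3.fderiv, e4.fderiv]
  dsimp only at hsymm
  refine ⟨?_, ?_, ?_, ?_, ?_, ?_⟩ <;> rw [Prod.ext_iff, Prod.ext_iff, Prod.ext_iff] <;>
    simp [Xf1, Xf2, Xf3, Xf4, Inv1, Inv2, Inv3, DxOp, hLv, hLpv, hLppv, hsymm] <;> grind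
end

section
/- Let U ⊆ ℝ³ be open with coordinates (x, y, p), let f : U → ℝ be smooth, and let M = {(x, y, p, a₃) : (x, y, p) ∈ U, a₃ ≠ 0} ⊆ ℝ⁴. Define at each point of M the covectors θ¹ = a₃·(((1/2)·f_p·p − f)·dx − (1/2)·f_p·dy + dp), θ² = a₃·(dy − p·dx), θ³ = dx, θ⁴ = ((1/2)·f_p − (1/2)·f_{pp}·p)·dx + (1/2)·f_{pp}·dy + (1/a₃)·da₃, and the vector fields X₁ = (1/a₃)·∂/∂p, X₂ = (1/a₃)·∂/∂y + (f_p/(2a₃))·∂/∂p − (1/2)·f_{pp}·∂/∂a₃, X₃ = ∂/∂x + p·∂/∂y + f·∂/∂p − (1/2)·f_p·a₃·∂/∂a₃, X₄ = a₃·∂/∂a₃. Then θⁱ(X_j) = δⁱ_j at every point of M; consequently, for every function H : M → ℝ differentiable at a point z ∈ M, the differential of H at z equals Σᵢ₌₁⁴ (XᵢH)(z)·θⁱ_z. -/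
/-- Invariant 1-form `θ¹ = a₃·(((1/2)·f_p·p - f)·dx - (1/2)·f_p·dy + dp)`,
as a covector at `z = (x, y, p, a₃)` acting on tangent vectors `v`. -/
noncomputable def Th1 (f : ℝ → ℝ → ℝ → ℝ) (z v : ℝ × ℝ × ℝ × ℝ) : ℝ :=
  z.2.2.2 * (((1 / 2) * pdp f z.1 z.2.1 z.2.2.1 * z.2.2.1 - f z.1 z.2.1 z.2.2.1) * v.1
    - (1 / 2) * pdp f z.1 z.2.1 z.2.2.1 * v.2.1 + v.2.2.1)

/-- Invariant 1-form `θ² = a₃·(dy - p·dx)`. -/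
noncomputable def Th2 (f : ℝ → ℝ → ℝ → ℝ) (z v : ℝ × ℝ × ℝ × ℝ) : ℝ :=
  z.2.2.2 * (v.2.1 - z.2.2.1 * v.1)

/-- Invariant 1-form `θ³ = dx`. -/
noncomputable def Th3 (f : ℝ → ℝ → ℝ → ℝ) (z v : ℝ × ℝ × ℝ × ℝ) : ℝ :=
  v.1

/-- Invariant 1-form `θ⁴ = ((1/2)·f_p - (1/2)·f_pp·p)·dx + (1/2)·f_pp·dy + (1/a₃)·da₃`. -/
noncomputable def Th4 (f : ℝ → ℝ → ℝ → ℝ) (z v : ℝ × ℝ × ℝ × ℝ) : ℝ :=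
  ((1 / 2) * pdp f z.1 z.2.1 z.2.2.1 - (1 / 2) * pdp (pdp f) z.1 z.2.1 z.2.2.1 * z.2.2.1) * v.1
    + (1 / 2) * pdp (pdp f) z.1 z.2.1 z.2.2.1 * v.2.1 + (1 / z.2.2.2) * v.2.2.2

/-- Every tangent vector at a point with `a₃ ≠ 0` expands in the invariant frame, with
coefficients given by the invariant coframe. -/
theorem eq_sum_coframe_smul_frame (f : ℝ → ℝ → ℝ → ℝ) {z : ℝ × ℝ × ℝ × ℝ}
    (hz : z.2.2.2 ≠ 0) (v : ℝ × ℝ × ℝ × ℝ) :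
    v = ∑ i : Fin 4, ![Th1 f z, Th2 f z, Th3 f z, Th4 f z] i v •
      ![Xf1 f z, Xf2 f z, Xf3 f z, Xf4 f z] i := by
  obtain ⟨x, y, p, a⟩ := z
  obtain ⟨v₁, v₂, v₃, v₄⟩ := v
  dsimp only at hz
  simp only [Fin.sum_univ_four, Th1, Th2, Th3, Th4, Xf1, Xf2, Xf3, Xf4, Matrix.cons_val,
    Prod.smul_mk, Prod.mk_add_mk, smul_eq_mul, Prod.mk.injEq]
  refine ⟨?_, ?_, ?_, ?_⟩ <;> field_simp <;> ring

/-- On `M = {(x, y, p, a₃) : (x, y, p) ∈ U, a₃ ≠ 0}`, the invariant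
coframe `θ¹, …, θ⁴` is dual to the invariant frame `X₁, …, X₄` (`θⁱ(X_j) = δⁱ_j`);
consequently, for every `H` differentiable at `z ∈ M`,
`dH_z = Σᵢ (XᵢH)(z)·θⁱ_z`. -/
theorem statement8
    (U : Set (ℝ × ℝ × ℝ)) (hUo : IsOpen U)
    (f : ℝ → ℝ → ℝ → ℝ)
    (hf : ContDiffOn ℝ (⊤ : ℕ∞) (fun w : ℝ × ℝ × ℝ => f w.1 w.2.1 w.2.2) U) :
    ∀ z ∈ {z : ℝ × ℝ × ℝ × ℝ | (z.1, z.2.1, z.2.2.1) ∈ U ∧ z.2.2.2 ≠ 0},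
      (∀ i j : Fin 4,
        ![Th1 f z, Th2 f z, Th3 f z, Th4 f z] i
            (![Xf1 f z, Xf2 f z, Xf3 f z, Xf4 f z] j) = if i = j then 1 else 0) ∧
      (∀ H : ℝ × ℝ × ℝ × ℝ → ℝ, DifferentiableAt ℝ H z →
        ∀ v : ℝ × ℝ × ℝ × ℝ,
          fderiv ℝ H z v =
            ∑ i : Fin 4,
              fderiv ℝ H z (![Xf1 f z, Xf2 f z, Xf3 f z, Xf4 f z] i)
                * ![Th1 f z, Th2 f z, Th3 f z, Th4 f z] i v) := by
  rintro z ⟨-, hz⟩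
  refine ⟨fun i j => ?_, fun H _ v => ?_⟩
  · fin_cases i <;> fin_cases j <;>
      simp [Th1, Th2, Th3, Th4, Xf1, Xf2, Xf3, Xf4, hz] <;> field_simp <;> ring
  · conv_lhs => rw [eq_sum_coframe_smul_frame f hz v]
    simp only [map_sum, map_smul, smul_eq_mul, mul_comm]
end

section
/- Let Ω ⊆ ℝ² be open and connected, let f : Ω × ℝ → ℝ be smooth, let C ∈ ℝ, and let η : Ω → ℝ be smooth with ∂η/∂y ≠ 0 everywhere. Suppose that for all (x, y) ∈ Ω and all p ∈ ℝ, η_{xx}(x,y) + 2p·η_{xy}(x,y) + p²·η_{yy}(x,y) + η_y(x,y)·f(x,y,p) = 6·η(x,y)² + x + C. Then η is uniquely determined by f: for all (x, y) ∈ Ω and all p ∈ ℝ, η(x,y) = (1/12)·f_y − (1/24)·f_{xp} − (1/24)·f_{pp}·f + (1/48)·f_p² − (1/24)·p·f_{yp} (the right-hand side being in particular independent of p). -/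
section PartialDerivatives

open Topology
open scoped ContDiff

variable {Ω : Set (ℝ × ℝ)} {g : ℝ → ℝ → ℝ} {x y : ℝ}

theorem eventually_mem_fst (hΩ : IsOpen Ω) (hw : (x, y) ∈ Ω) : ∀ᶠ t in 𝓝 x, (t, y) ∈ Ω :=
  (by fun_prop : ContinuousAt (fun t : ℝ => (t, y)) x).eventually (hΩ.mem_nhds hw)

theorem eventually_mem_snd (hΩ : IsOpen Ω) (hw : (x, y) ∈ Ω) : ∀ᶠ t in 𝓝 y, (x, t) ∈ Ω :=
  (by fun_prop : ContinuousAt (fun t : ℝ => (x, t)) y).eventually (hΩ.mem_nhds hw)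

theorem hasDerivAt_fst_of_differentiableAt
    (hg : DifferentiableAt ℝ (fun w : ℝ × ℝ => g w.1 w.2) (x, y)) :
    HasDerivAt (fun t => g t y) (fderiv ℝ (fun w : ℝ × ℝ => g w.1 w.2) (x, y) (1, 0)) x :=
  HasFDerivAt.comp_hasDerivAt (f := fun t : ℝ => (t, y)) x hg.hasFDerivAt
    ((hasDerivAt_id x).prodMk (hasDerivAt_const x y))

theorem hasDerivAt_snd_of_differentiableAt
    (hg : DifferentiableAt ℝ (fun w : ℝ × ℝ => g w.1 w.2) (x, y)) :
    HasDerivAt (fun t => g x t) (fderiv ℝ (fun w : ℝ × ℝ => g w.1 w.2) (x, y) (0, 1)) y :=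
  HasFDerivAt.comp_hasDerivAt (f := fun t : ℝ => (x, t)) y hg.hasFDerivAt
    ((hasDerivAt_const y x).prodMk (hasDerivAt_id y))

theorem differentiableAt_of_contDiffOn (hΩ : IsOpen Ω)
    (hg : ContDiffOn ℝ ∞ (fun w : ℝ × ℝ => g w.1 w.2) Ω) (hw : (x, y) ∈ Ω) :
    DifferentiableAt ℝ (fun w : ℝ × ℝ => g w.1 w.2) (x, y) :=
  (hg.contDiffAt (hΩ.mem_nhds hw)).differentiableAt (by simp)

theorem hasDerivAt_edx_s9 (hΩ : IsOpen Ω)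
    (hg : ContDiffOn ℝ ∞ (fun w : ℝ × ℝ => g w.1 w.2) Ω) (hw : (x, y) ∈ Ω) :
    HasDerivAt (fun t => g t y) (edx g x y) x :=
  (hasDerivAt_fst_of_differentiableAt
    (differentiableAt_of_contDiffOn hΩ hg hw)).differentiableAt.hasDerivAt

theorem hasDerivAt_edy_s9 (hΩ : IsOpen Ω)
    (hg : ContDiffOn ℝ ∞ (fun w : ℝ × ℝ => g w.1 w.2) Ω) (hw : (x, y) ∈ Ω) :
    HasDerivAt (fun t => g x t) (edy g x y) y :=
  (hasDerivAt_snd_of_differentiableAt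
    (differentiableAt_of_contDiffOn hΩ hg hw)).differentiableAt.hasDerivAt

theorem edx_eq_fderiv (hΩ : IsOpen Ω)
    (hg : ContDiffOn ℝ ∞ (fun w : ℝ × ℝ => g w.1 w.2) Ω) (hw : (x, y) ∈ Ω) :
    edx g x y = fderiv ℝ (fun w : ℝ × ℝ => g w.1 w.2) (x, y) (1, 0) :=
  (hasDerivAt_fst_of_differentiableAt (differentiableAt_of_contDiffOn hΩ hg hw)).deriv

theorem edy_eq_fderiv (hΩ : IsOpen Ω)
    (hg : ContDiffOn ℝ ∞ (fun w : ℝ × ℝ => g w.1 w.2) Ω) (hw : (x, y) ∈ Ω) :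
    edy g x y = fderiv ℝ (fun w : ℝ × ℝ => g w.1 w.2) (x, y) (0, 1) :=
  (hasDerivAt_snd_of_differentiableAt (differentiableAt_of_contDiffOn hΩ hg hw)).deriv

theorem contDiffOn_edx (hΩ : IsOpen Ω)
    (hg : ContDiffOn ℝ ∞ (fun w : ℝ × ℝ => g w.1 w.2) Ω) :
    ContDiffOn ℝ ∞ (fun w : ℝ × ℝ => edx g w.1 w.2) Ω :=
  ((hg.fderiv_of_isOpen (m := ∞) hΩ (by simp)).clm_apply contDiffOn_const).congr
    fun _ hw => edx_eq_fderiv hΩ hg hw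

theorem contDiffOn_edy (hΩ : IsOpen Ω)
    (hg : ContDiffOn ℝ ∞ (fun w : ℝ × ℝ => g w.1 w.2) Ω) :
    ContDiffOn ℝ ∞ (fun w : ℝ × ℝ => edy g w.1 w.2) Ω :=
  ((hg.fderiv_of_isOpen (m := ∞) hΩ (by simp)).clm_apply contDiffOn_const).congr
    fun _ hw => edy_eq_fderiv hΩ hg hw

theorem edy_edx_eq_edx_edy (hΩ : IsOpen Ω)
    (hg : ContDiffOn ℝ ∞ (fun w : ℝ × ℝ => g w.1 w.2) Ω) (hw : (x, y) ∈ Ω) :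
    edy (edx g) x y = edx (edy g) x y := by
  have hnhds : ∀ᶠ w in 𝓝 (x, y), w ∈ Ω := hΩ.mem_nhds hw
  have hd : DifferentiableAt ℝ (fderiv ℝ fun w : ℝ × ℝ => g w.1 w.2) (x, y) :=
    ((hg.fderiv_of_isOpen (m := ∞) hΩ (by simp)).contDiffAt (hΩ.mem_nhds hw)).differentiableAt
      (by simp)
  have hx : (fun w : ℝ × ℝ => edx g w.1 w.2) =ᶠ[𝓝 (x, y)]
      fun w => fderiv ℝ (fun w : ℝ × ℝ => g w.1 w.2) w (1, 0) :=
    hnhds.mono fun w h => edx_eq_fderiv hΩ hg h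
  have hy : (fun w : ℝ × ℝ => edy g w.1 w.2) =ᶠ[𝓝 (x, y)]
      fun w => fderiv ℝ (fun w : ℝ × ℝ => g w.1 w.2) w (0, 1) :=
    hnhds.mono fun w h => edy_eq_fderiv hΩ hg h
  rw [edy_eq_fderiv hΩ (contDiffOn_edx hΩ hg) hw, edx_eq_fderiv hΩ (contDiffOn_edy hΩ hg) hw,
    hx.fderiv_eq, hy.fderiv_eq, fderiv_clm_apply hd (differentiableAt_const _),
    fderiv_clm_apply hd (differentiableAt_const _)]
  simpa using ((hg.contDiffAt (hΩ.mem_nhds hw)).isSymmSndFDerivAt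
    (by simpa using WithTop.coe_le_coe.2 (le_top : (2 : ℕ∞) ≤ ⊤))).eq (0, 1) (1, 0)

end PartialDerivatives

theorem hasDerivAt_quadratic_div (A B D a p : ℝ) :
    HasDerivAt (fun t : ℝ => (A - 2 * t * B - t ^ 2 * D) / a) ((-2 * B - 2 * p * D) / a) p := by
  have h := ((((hasDerivAt_id p).const_mul 2).mul_const B).const_sub A |>.sub
    (((hasDerivAt_id p).pow 2).mul_const D)).div_const a
  exact h.congr_deriv (by simp)

theorem hasDerivAt_const_quadratic_div {A B D a : ℝ → ℝ} {A' B' D' a' s : ℝ} (p : ℝ)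
    (hA : HasDerivAt A A' s) (hB : HasDerivAt B B' s) (hD : HasDerivAt D D' s)
    (ha : HasDerivAt a a' s) (h0 : a s ≠ 0) :
    HasDerivAt (fun t => (A t - 2 * p * B t - p ^ 2 * D t) / a t)
      (((A' - 2 * p * B' - p ^ 2 * D')
        - (A s - 2 * p * B s - p ^ 2 * D s) / a s * a') / a s) s := by
  have h := ((hA.sub (hB.const_mul (2 * p))).sub (hD.const_mul (p ^ 2))).div ha h0
  refine h.congr_deriv ?_
  simp only [Pi.sub_apply]
  field_simp

theorem hasDerivAt_quadratic_logDeriv (A' B' D' A B D a a' p : ℝ) :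
    HasDerivAt (fun t : ℝ => ((A' - 2 * t * B' - t ^ 2 * D')
        - (A - 2 * t * B - t ^ 2 * D) / a * a') / a)
      (((-2 * B' - 2 * p * D') - (-2 * B - 2 * p * D) / a * a') / a) p := by
  have h' : HasDerivAt (fun t : ℝ => A' - 2 * t * B' - t ^ 2 * D') (-2 * B' - 2 * p * D') p := by
    simpa only [div_one] using hasDerivAt_quadratic_div A' B' D' 1 p
  exact (h'.sub ((hasDerivAt_quadratic_div A B D a p).mul_const a')).div_const a

/-- If the transformation `(x, y) ↦ (x + C, η(x, y))` maps
`y'' = f(x, y, y')` to the first Painlevé equation `ȳ'' = 6ȳ² + x̄` (expressed by the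
prolongation identity `η_xx + 2p·η_xy + p²·η_yy + η_y·f = 6η² + x + C` on `Ω × ℝ`),
then `η` is determined by `f`:
`η = (1/12)·f_y - (1/24)·f_xp - (1/24)·f_pp·f + (1/48)·f_p² - (1/24)·p·f_yp`. -/
theorem statement9
    (Ω : Set (ℝ × ℝ)) (hΩo : IsOpen Ω) (hΩc : IsConnected Ω)
    (f : ℝ → ℝ → ℝ → ℝ)
    (hf : ContDiffOn ℝ (⊤ : ℕ∞) (fun z : ℝ × ℝ × ℝ => f z.1 z.2.1 z.2.2)
      {z : ℝ × ℝ × ℝ | (z.1, z.2.1) ∈ Ω})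
    (C : ℝ) (η : ℝ → ℝ → ℝ)
    (hη : ContDiffOn ℝ (⊤ : ℕ∞) (fun w : ℝ × ℝ => η w.1 w.2) Ω)
    (hηy : ∀ w ∈ Ω, edy η w.1 w.2 ≠ 0)
    (hpde : ∀ w ∈ Ω, ∀ p : ℝ,
      edx (edx η) w.1 w.2 + 2 * p * edx (edy η) w.1 w.2
        + p ^ 2 * edy (edy η) w.1 w.2 + edy η w.1 w.2 * f w.1 w.2 p
      = 6 * (η w.1 w.2) ^ 2 + w.1 + C) :
    ∀ w ∈ Ω, ∀ p : ℝ,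
      η w.1 w.2 =
        (1 / 12) * pdy f w.1 w.2 p - (1 / 24) * pdp (pdx f) w.1 w.2 p
          - (1 / 24) * pdp (pdp f) w.1 w.2 p * f w.1 w.2 p
          + (1 / 48) * (pdp f w.1 w.2 p) ^ 2
          - (1 / 24) * p * pdp (pdy f) w.1 w.2 p := by
  rintro ⟨x, y⟩ hw p
  have hηx' := contDiffOn_edx hΩo hη
  have hηy' := contDiffOn_edy hΩo hη
  have hηxx := contDiffOn_edx hΩo hηx'
  have hηxy := contDiffOn_edx hΩo hηy'
  have hηyy := contDiffOn_edy hΩo hηy'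
  set A : ℝ → ℝ → ℝ := fun x y => 6 * η x y ^ 2 + x + C - edx (edx η) x y with hA
  have hfeq : ∀ u v q, (u, v) ∈ Ω → f u v q =
      (A u v - 2 * q * edx (edy η) u v - q ^ 2 * edy (edy η) u v) / edy η u v := by
    intro u v q huv
    rw [eq_div_iff (hηy _ huv)]
    simp only [hA]
    linear_combination hpde _ huv q
  have ha0 : edy η x y ≠ 0 := hηy _ hw
  have hAx : HasDerivAt (fun t => A t y)
      (12 * η x y * edx η x y + 1 - edx (edx (edx η)) x y) x := by
    have h := (((((hasDerivAt_edx_s9 hΩo hη hw).pow 2).const_mul 6).add (hasDerivAt_id x)).add_const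
      C).sub (hasDerivAt_edx_s9 hΩo hηxx hw)
    refine h.congr_deriv ?_
    simp
    ring
  have hAy : HasDerivAt (fun t => A x t)
      (12 * η x y * edy η x y - edx (edx (edy η)) x y) y := by
    have hsymm : edy (edx (edx η)) x y = edx (edx (edy η)) x y := by
      rw [edy_edx_eq_edx_edy hΩo hηx' hw]
      refine Filter.EventuallyEq.deriv_eq ?_
      filter_upwards [eventually_mem_fst hΩo hw] with t ht using edy_edx_eq_edx_edy hΩo hη ht
    have h := (((((hasDerivAt_edy_s9 hΩo hη hw).pow 2).const_mul 6).add_const x).add_const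
      C).sub (hasDerivAt_edy_s9 hΩo hηxx hw)
    rw [hsymm] at h
    refine h.congr_deriv ?_
    simp
    ring
  have hp : ∀ q, pdp f x y q =
      (-2 * edx (edy η) x y - 2 * q * edy (edy η) x y) / edy η x y := fun q => by
    simp only [pdp, hfeq x y _ hw]
    exact (hasDerivAt_quadratic_div _ _ _ _ q).deriv
  have hpp : pdp (pdp f) x y p = -2 * edy (edy η) x y / edy η x y := by
    rw [pdp, funext hp]
    simp
  have hx : ∀ q, pdx f x y q = _ := fun q =>
    (Filter.EventuallyEq.deriv_eq ((eventually_mem_fst hΩo hw).mono fun t ht =>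
      hfeq t y q ht)).trans (hasDerivAt_const_quadratic_div q hAx (hasDerivAt_edx_s9 hΩo hηxy hw)
        (hasDerivAt_edx_s9 hΩo hηyy hw) (hasDerivAt_edx_s9 hΩo hηy' hw) ha0).deriv
  have hy : ∀ q, pdy f x y q = _ := fun q =>
    (Filter.EventuallyEq.deriv_eq ((eventually_mem_snd hΩo hw).mono fun t ht =>
      hfeq x t q ht)).trans (hasDerivAt_const_quadratic_div q hAy (hasDerivAt_edy_s9 hΩo hηxy hw)
        (hasDerivAt_edy_s9 hΩo hηyy hw) (hasDerivAt_edy_s9 hΩo hηy' hw) ha0).deriv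
  have hxp : pdp (pdx f) x y p = _ :=
    (congrArg (fun k => deriv k p) (funext hx)).trans
      (hasDerivAt_quadratic_logDeriv _ _ _ _ _ _ _ _ p).deriv
  have hyp : pdp (pdy f) x y p = _ :=
    (congrArg (fun k => deriv k p) (funext hy)).trans
      (hasDerivAt_quadratic_logDeriv _ _ _ _ _ _ _ _ p).deriv
  have hsymm : edy (edx (edy η)) x y = edx (edy (edy η)) x y := edy_edx_eq_edx_edy hΩo hηy' hw
  simp only [hxp, hyp, hy, hpp, hp, hfeq x y p hw, hsymm]
  field_simp
  ring
end
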